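/- arXiv:1609.03511 — 3 statements merged into one kernel-verified Lean document; each statement's English description precedes it below -/
import Mathlib

section
/- Let k be a positive integer, let c₁, c₂ ∈ (0,∞)^k with c₁ ≠ c₂, and let p₁, p₂ > 0. Then there is a constant C (depending on c₁, c₂, p₁, p₂) such that for all n ≥ 2, ∑_{x ∈ ℤ₊^k} min{𝒫_{ln(n)·c₁}(x)·p₁, 𝒫_{ln(n)·c₂}(x)·p₂} ≤ C · n^{−D₊(c₁,c₂)} · (ln n)^{−1/2}. -/
open scoped BigOperators

/-- The multivariate Poisson probability mass function with mean vector `lam`. -/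
noncomputable def mvPoisson {k : ℕ} (lam : Fin k → ℝ) (x : Fin k → ℕ) : ℝ :=
  ∏ i, lam i ^ (x i) * Real.exp (-lam i) / (Nat.factorial (x i) : ℝ)

/-- The Chernoff–Hellinger divergence
`D₊(c₁,c₂) = max_{t∈[0,1]} ∑ᵢ (t c₁(i) + (1-t) c₂(i) - c₁(i)^t c₂(i)^{1-t})`. -/
noncomputable def Dplus {k : ℕ} (c₁ c₂ : Fin k → ℝ) : ℝ :=
  sSup ((fun t : ℝ => ∑ i, (t * c₁ i + (1 - t) * c₂ i - c₁ i ^ t * c₂ i ^ (1 - t))) ''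
    Set.Icc (0 : ℝ) 1)

namespace PoissonAux

lemma hasSum_pi_one : ∀ (k : ℕ) (f : Fin k → ℕ → ℝ), (∀ i x, 0 ≤ f i x) →
    (∀ i, HasSum (f i) 1) → HasSum (fun x : Fin k → ℕ => ∏ i, f i (x i)) 1 := by
  intro k
  induction k with
  | zero =>
    intro f _ _
    simp
  | succ k ih =>
    intro f h0 h1
    have h2 := ih (fun i => f i.succ) (fun i x => h0 _ _) (fun i => h1 _)
    have h4 : Summable (fun p : ℕ × (Fin k → ℕ) => f 0 p.1 * ∏ i : Fin k, f i.succ (p.2 i)) := by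
      refine Summable.mul_of_nonneg (f := f 0)
        (g := fun z : Fin k → ℕ => ∏ i : Fin k, f i.succ (z i)) (h1 0).summable h2.summable ?_ ?_
      · intro x
        exact h0 0 x
      · intro x
        exact Finset.prod_nonneg (fun i _ => h0 i.succ (x i))
    have h3 := HasSum.mul (h1 0) h2 h4
    rw [one_mul] at h3
    rw [← (Fin.consEquiv (fun _ : Fin (k+1) => ℕ)).hasSum_iff]
    have e : (fun x : Fin (k + 1) → ℕ => ∏ i, f i (x i)) ∘
        (Fin.consEquiv (fun _ : Fin (k+1) => ℕ)) =
        fun p : ℕ × (Fin k → ℕ) => f 0 p.1 * ∏ i : Fin k, f i.succ (p.2 i) := by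
      funext p
      simp [Fin.prod_univ_succ, Fin.consEquiv]
    rw [e]
    exact h3

/-- one dimensional Poisson pmf -/
noncomputable def pois (l : ℝ) (x : ℕ) : ℝ := l ^ x * Real.exp (-l) / (Nat.factorial x : ℝ)

lemma pois_nonneg {l : ℝ} (hl : 0 ≤ l) (x : ℕ) : 0 ≤ pois l x := by
  unfold pois; positivity

lemma hasSum_pois (l : ℝ) : HasSum (pois l) 1 := by
  have h : HasSum (fun x : ℕ => l ^ x / (Nat.factorial x : ℝ)) (Real.exp l) := by
    have := NormedSpace.expSeries_div_hasSum_exp (𝔸 := ℝ) l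
    rwa [← Real.exp_eq_exp_ℝ] at this
  have h2 := h.mul_right (Real.exp (-l))
  rw [← Real.exp_add, add_neg_cancel, Real.exp_zero] at h2
  have e : pois l = fun x : ℕ => l ^ x / (Nat.factorial x : ℝ) * Real.exp (-l) := by
    funext x
    unfold pois
    ring
  rw [e]
  exact h2

lemma pois_le_one {l : ℝ} (hl : 0 ≤ l) (x : ℕ) : pois l x ≤ 1 :=
  le_hasSum (hasSum_pois l) x (fun j _ => pois_nonneg hl j)

lemma pois_le_of_large {l : ℝ} (hl : 0 < l) (x : ℕ) (hx : 1 ≤ x) :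
    pois l x ≤ 1 / √x := by
  have hx0 : (0 : ℝ) < x := by exact_mod_cast hx
  have hs := Stirling.le_factorial_stirling x
  have h1 : √(x : ℝ) * (x / Real.exp 1) ^ x ≤ (Nat.factorial x : ℝ) := by
    refine le_trans ?_ hs
    gcongr
    nlinarith [Real.pi_gt_three]
  have h2 : l ^ x * Real.exp (-l) ≤ (x / Real.exp 1) ^ x := by
    have h3 : l / x ≤ Real.exp (l / x - 1) := by
      have := Real.add_one_le_exp (l / x - 1); linarith
    have h4 : (l / x) ^ x ≤ Real.exp (l - x) := by
      calc (l / x) ^ x ≤ (Real.exp (l / x - 1)) ^ x := by gcongr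
        _ = Real.exp (l - x) := by
          rw [← Real.exp_nat_mul]; congr 1; field_simp
    have h5 : l ^ x = (l / x) ^ x * (x : ℝ) ^ x := by
      rw [div_pow]; field_simp
    rw [h5, div_pow (x : ℝ) (Real.exp 1), ← Real.exp_nat_mul, mul_one]
    calc (l / x) ^ x * (x : ℝ) ^ x * Real.exp (-l)
        ≤ Real.exp (l - x) * (x : ℝ) ^ x * Real.exp (-l) := by gcongr
      _ = (x : ℝ) ^ x / Real.exp x := by
        rw [Real.exp_sub, Real.exp_neg]; field_simp
  unfold pois
  have hf : (0 : ℝ) < Nat.factorial x := by positivity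
  have hsq : 0 < √(x : ℝ) := Real.sqrt_pos.mpr hx0
  rw [div_le_div_iff₀ hf hsq]
  nlinarith

lemma pois_mono_step {l : ℝ} (hl : 0 < l) (x : ℕ) (hx : ((x + 1 : ℕ) : ℝ) ≤ l) :
    pois l x ≤ pois l (x + 1) := by
  have h : pois l (x + 1) = pois l x * (l / ((x + 1 : ℕ) : ℝ)) := by
    unfold pois
    rw [Nat.factorial_succ, pow_succ]
    push_cast
    field_simp
  rw [h]
  have : 1 ≤ l / ((x + 1 : ℕ) : ℝ) := by
    rw [le_div_iff₀ (by positivity)]; linarith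
  exact le_mul_of_one_le_right (pois_nonneg hl.le x) this

lemma pois_le {l : ℝ} (hl : 0 < l) (x : ℕ) : pois l x ≤ 2 / √l := by
  have hsl : 0 < √l := Real.sqrt_pos.mpr hl
  rcases lt_or_ge l 1 with h | h
  · refine (pois_le_one hl.le x).trans ?_
    rw [le_div_iff₀ hsl]
    have : √l ≤ 1 := Real.sqrt_le_one.mpr h.le
    linarith
  · have key : ∀ y : ℕ, ⌊l⌋₊ ≤ y → pois l y ≤ 2 / √l := by
      intro y hy
      have hf : 1 ≤ ⌊l⌋₊ := Nat.one_le_floor_iff l |>.mpr h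
      have hy1 : 1 ≤ y := hf.trans hy
      refine (pois_le_of_large hl y hy1).trans ?_
      have hlt := Nat.lt_floor_add_one l
      have hy2 : (⌊l⌋₊ : ℝ) ≤ y := by exact_mod_cast hy
      have hy3 : (1 : ℝ) ≤ y := by exact_mod_cast hy1
      have hsy : 0 < √(y : ℝ) := Real.sqrt_pos.mpr (by linarith)
      rw [div_le_div_iff₀ hsy hsl, one_mul]
      rw [Real.sqrt_le_left (by positivity), mul_pow, Real.sq_sqrt (by linarith)]
      linarith
    rcases le_total ⌊l⌋₊ x with hx | hx
    · exact key x hx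
    · refine le_trans ?_ (key _ le_rfl)
      have : ∀ y, x ≤ y → y ≤ ⌊l⌋₊ → pois l x ≤ pois l y := by
        intro y hxy
        induction y, hxy using Nat.le_induction with
        | base => intro _; exact le_rfl
        | succ y hy ih =>
          intro h'
          refine (ih (by omega)).trans (pois_mono_step hl y ?_)
          exact (Nat.le_floor_iff hl.le).mp h'
      exact this _ hx le_rfl

lemma summable_int_exp {s : ℝ} (hs : 0 < s) :
    Summable (fun z : ℤ => Real.exp (-(s * |(z : ℝ)|))) := by
  have h : Summable (fun n : ℕ => Real.exp (-(s * (n : ℝ)))) := by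
    have := Real.summable_exp_nat_mul_iff.mpr (neg_lt_zero.mpr hs)
    refine this.congr ?_
    intro n
    congr 1; ring
  apply Summable.of_nat_of_neg
  · refine h.congr ?_
    intro n; simp
  · refine h.congr ?_
    intro n; simp

lemma exp_sum_bound {s w : ℝ} (hs : 0 < s) (hw : w ≠ 0) :
    ∃ K : ℝ, 0 ≤ K ∧ ∀ b : ℝ, Summable (fun y : ℕ => Real.exp (-(s * |w * y + b|))) ∧
      ∑' y : ℕ, Real.exp (-(s * |w * y + b|)) ≤ K := by
  have hr : 0 < s * |w| := mul_pos hs (abs_pos.mpr hw)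
  set r := s * |w| with hrdef
  have hS := summable_int_exp hr
  refine ⟨Real.exp r * ∑' z : ℤ, Real.exp (-(r * |(z : ℝ)|)), by positivity, ?_⟩
  intro b
  set N : ℤ := ⌊-(b / w)⌋ with hN
  have hinj : Function.Injective (fun y : ℕ => (y : ℤ) - N) := by
    intro a c h; simpa using h
  have hS2 : Summable (fun y : ℕ => Real.exp r * Real.exp (-(r * |(((y : ℤ) - N : ℤ) : ℝ)|))) :=
    (hS.comp_injective hinj).mul_left _
  have hle : ∀ y : ℕ, Real.exp (-(s * |w * y + b|)) ≤
      Real.exp r * Real.exp (-(r * |(((y : ℤ) - N : ℤ) : ℝ)|)) := by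
    intro y
    rw [← Real.exp_add]
    apply Real.exp_le_exp.mpr
    have h1 : w * y + b = w * (y + b / w) := by field_simp
    rw [h1, abs_mul, ← mul_assoc, ← hrdef]
    have h2 : |(((y : ℤ) - N : ℤ) : ℝ)| ≤ |(y : ℝ) + b / w| + 1 := by
      have e : (((y : ℤ) - N : ℤ) : ℝ) = ((y : ℝ) + b / w) + (-(b / w) - N) := by
        push_cast; ring
      rw [e]
      refine (abs_add_le _ _).trans ?_
      have := Int.floor_le (-(b / w))
      have := Int.lt_floor_add_one (-(b / w))
      have : |-(b / w) - N| ≤ 1 := by rw [abs_le]; constructor <;> linarith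
      linarith
    nlinarith
  have hS3 := Summable.of_nonneg_of_le (fun y => (Real.exp_pos _).le) hle hS2
  refine ⟨hS3, (hS3.tsum_le_tsum hle hS2).trans ?_⟩
  rw [tsum_mul_left]
  refine mul_le_mul_of_nonneg_left ?_ (Real.exp_pos _).le
  exact tsum_comp_le_tsum_of_inj hS (fun z => (Real.exp_pos _).le) hinj

lemma mvPoisson_eq {k : ℕ} (l : Fin k → ℝ) (x : Fin k → ℕ) :
    mvPoisson l x = ∏ i, pois (l i) (x i) := rfl

lemma mvPoisson_tilt {k : ℕ} (L : ℝ) (c m v : Fin k → ℝ) (h : ∀ i, c i = m i * Real.exp (v i))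
    (x : Fin k → ℕ) :
    mvPoisson (fun i => L * c i) x = mvPoisson (fun i => L * m i) x *
      Real.exp (∑ i, v i * x i - L * ∑ i, (c i - m i)) := by
  rw [Finset.mul_sum, ← Finset.sum_sub_distrib, Real.exp_sum]
  unfold mvPoisson
  rw [← Finset.prod_mul_distrib]
  refine Finset.prod_congr rfl fun i _ => ?_
  have e : Real.exp (v i * x i - L * (c i - m i)) =
      Real.exp (v i) ^ (x i) * (Real.exp (-(L * c i)) * Real.exp (L * m i)) := by
    rw [← Real.exp_nat_mul, ← Real.exp_add, ← Real.exp_add]; congr 1; ring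
  have e2 : Real.exp (-(L * m i)) * Real.exp (L * m i) = 1 := by
    rw [← Real.exp_add]; simp
  rw [e]
  have e3 : (L * c i) ^ x i = (L * m i) ^ x i * Real.exp (v i) ^ x i := by
    rw [← mul_pow, h i]; congr 1; ring
  rw [e3]
  linear_combination (-((L * m i) ^ x i * Real.exp (v i) ^ x i * Real.exp (-(L * c i)) /
    (Nat.factorial (x i) : ℝ))) * e2

/-- anti-concentration bound -/
lemma anti {k : ℕ} (i : Fin (k + 1)) (w m : Fin (k + 1) → ℝ) (hm : ∀ i, 0 < m i) (hw : w i ≠ 0)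
    (s : ℝ) (hs : 0 < s) : ∃ K : ℝ, ∀ L : ℝ, 0 < L → ∀ b : ℝ,
    Summable (fun x : Fin (k + 1) → ℕ =>
      mvPoisson (fun i => L * m i) x * Real.exp (-(s * |∑ j, w j * x j - b|))) ∧
    ∑' x : Fin (k + 1) → ℕ,
      mvPoisson (fun i => L * m i) x * Real.exp (-(s * |∑ j, w j * x j - b|)) ≤
      K / √L := by
  obtain ⟨K, hK, hKb⟩ := exp_sum_bound hs hw
  refine ⟨2 / √(m i) * K, ?_⟩
  intro L hL b
  have hl : ∀ j, 0 < L * m j := fun j => mul_pos hL (hm j)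
  have hq := hasSum_pi_one (k + 1) (fun j => pois (L * m j)) (fun j x => pois_nonneg (hl j).le x)
    (fun j => hasSum_pois _)
  have hz := hasSum_pi_one k (fun j => pois (L * m (i.succAbove j)))
    (fun j x => pois_nonneg (hl _).le x) (fun j => hasSum_pois _)
  have hS : Summable (fun x : Fin (k + 1) → ℕ =>
      mvPoisson (fun i => L * m i) x * Real.exp (-(s * |∑ j, w j * x j - b|))) := by
    refine Summable.of_nonneg_of_le (fun x => ?_) (fun x => ?_) hq.summable
    · rw [mvPoisson_eq]
      exact mul_nonneg (Finset.prod_nonneg fun j _ => pois_nonneg (hl j).le _) (Real.exp_pos _).le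
    · rw [mvPoisson_eq]
      refine mul_le_of_le_one_right (Finset.prod_nonneg fun j _ => pois_nonneg (hl j).le _) ?_
      rw [Real.exp_le_one_iff]
      have := abs_nonneg (∑ j, w j * x j - b)
      nlinarith
  refine ⟨hS, ?_⟩
  let e : (Fin k → ℕ) × ℕ ≃ (Fin (k + 1) → ℕ) :=
    (Equiv.prodComm _ _).trans (Fin.insertNthEquiv (fun _ : Fin (k + 1) => ℕ) i)
  have hterm : ∀ (z : Fin k → ℕ) (y : ℕ),
      mvPoisson (fun i => L * m i) (e (z, y)) *
        Real.exp (-(s * |∑ j, w j * (e (z, y)) j - b|)) =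
      (∏ j, pois (L * m (i.succAbove j)) (z j)) * (pois (L * m i) y *
        Real.exp (-(s * |w i * y + (∑ j, w (i.succAbove j) * z j - b)|))) := by
    intro z y
    rw [mvPoisson_eq, Fin.prod_univ_succAbove _ i, Fin.sum_univ_succAbove _ i]
    simp only [e, Equiv.trans_apply, Equiv.prodComm_apply, Prod.swap_prod_mk,
      Fin.insertNthEquiv_apply, Fin.insertNth_apply_same, Fin.insertNth_apply_succAbove]
    rw [add_sub_assoc]
    ring
  have hSe : Summable (fun p : (Fin k → ℕ) × ℕ => mvPoisson (fun i => L * m i) (e p) *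
        Real.exp (-(s * |∑ j, w j * (e p) j - b|))) := (e.summable_iff).mpr hS
  rw [← e.tsum_eq, Summable.tsum_prod hSe]
  have hMpos : 0 ≤ 2 / √(L * m i) := by positivity
  have hfib : ∀ z : Fin k → ℕ,
      ∑' y : ℕ, mvPoisson (fun i => L * m i) (e (z, y)) *
        Real.exp (-(s * |∑ j, w j * (e (z, y)) j - b|)) ≤
      (∏ j, pois (L * m (i.succAbove j)) (z j)) * (2 / √(L * m i) * K) := by
    intro z
    simp only [hterm]
    rw [tsum_mul_left]
    refine mul_le_mul_of_nonneg_left ?_ (Finset.prod_nonneg fun j _ => pois_nonneg (hl _).le _)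
    obtain ⟨h1, h2⟩ := hKb (∑ j, w (i.succAbove j) * z j - b)
    have hle : ∀ y : ℕ, pois (L * m i) y *
        Real.exp (-(s * |w i * y + (∑ j, w (i.succAbove j) * z j - b)|)) ≤ 2 / √(L * m i) *
        Real.exp (-(s * |w i * y + (∑ j, w (i.succAbove j) * z j - b)|)) := fun y =>
      mul_le_mul_of_nonneg_right (pois_le (hl i) y) (Real.exp_pos _).le
    have hs1 := h1.mul_left (2 / √(L * m i))
    have hs2 := Summable.of_nonneg_of_le
      (fun y => mul_nonneg (pois_nonneg (hl i).le y) (Real.exp_pos _).le) hle hs1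
    refine (hs2.tsum_le_tsum hle hs1).trans ?_
    rw [tsum_mul_left]
    exact mul_le_mul_of_nonneg_left h2 hMpos
  have hsum := hz.mul_right (2 / √(L * m i) * K)
  refine (Summable.tsum_le_tsum hfib hSe.prod hsum.summable).trans ?_
  rw [hsum.tsum_eq, one_mul, Real.sqrt_mul hL.le]
  apply le_of_eq
  have := Real.sqrt_pos.mpr hL
  have := Real.sqrt_pos.mpr (hm i)
  field_simp

lemma exists_t {k : ℕ} (c₁ c₂ : Fin k → ℝ)
    (hc₁ : ∀ i, 0 < c₁ i) (hc₂ : ∀ i, 0 < c₂ i) (hne : c₁ ≠ c₂) :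
    ∃ t : ℝ, 0 < t ∧ t < 1 ∧ Dplus c₁ c₂ =
      ∑ i, (t * c₁ i + (1 - t) * c₂ i - c₁ i ^ t * c₂ i ^ (1 - t)) := by
  set F : ℝ → ℝ := fun t => ∑ i, (t * c₁ i + (1 - t) * c₂ i - c₁ i ^ t * c₂ i ^ (1 - t)) with hF
  have hcont : Continuous F := by
    refine continuous_finsetSum _ fun i _ => ?_
    have h1 : Continuous fun t : ℝ => c₁ i ^ t := Real.continuous_const_rpow (hc₁ i).ne'
    have h2 : Continuous fun t : ℝ => c₂ i ^ (1 - t) :=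
      (Real.continuous_const_rpow (hc₂ i).ne').comp (by fun_prop)
    fun_prop
  obtain ⟨t, ht, hmax⟩ := isCompact_Icc.exists_isMaxOn (s := Set.Icc (0 : ℝ) 1)
    ⟨0, by simp⟩ hcont.continuousOn
  have hD : Dplus c₁ c₂ = F t := by
    have : IsGreatest (F '' Set.Icc (0 : ℝ) 1) (F t) := by
      refine ⟨⟨t, ht, rfl⟩, ?_⟩
      rintro _ ⟨u, hu, rfl⟩
      exact hmax hu
    exact this.csSup_eq
  have hhalf : 0 < F (1 / 2) := by
    have key : ∀ i, (1 / 2 * c₁ i + (1 - 1 / 2) * c₂ i - c₁ i ^ (1 / 2 : ℝ) *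
        c₂ i ^ (1 - 1 / 2 : ℝ)) = (√(c₁ i) - √(c₂ i)) ^ 2 / 2 := by
      intro i
      have : (1 - 1 / 2 : ℝ) = 1 / 2 := by norm_num
      rw [this, ← Real.sqrt_eq_rpow, ← Real.sqrt_eq_rpow]
      have h1 := Real.sq_sqrt (hc₁ i).le
      have h2 := Real.sq_sqrt (hc₂ i).le
      linear_combination (-1 / 2) * h1 + (-1 / 2) * h2
    simp only [hF, key]
    obtain ⟨i, hi⟩ := Function.ne_iff.mp hne
    refine Finset.sum_pos' (fun j _ => by positivity) ⟨i, Finset.mem_univ _, ?_⟩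
    have : √(c₁ i) - √(c₂ i) ≠ 0 := by
      intro h
      exact hi ((Real.sqrt_inj (hc₁ i).le (hc₂ i).le).mp (by linarith))
    positivity
  have hle : F (1 / 2) ≤ F t := hmax (show (1 / 2 : ℝ) ∈ Set.Icc (0 : ℝ) 1 by norm_num)
  refine ⟨t, lt_of_le_of_ne ht.1 ?_, lt_of_le_of_ne ht.2 ?_, hD⟩
  · rintro rfl
    have : F 0 = 0 := by simp [hF]
    linarith
  · rintro rfl
    have : F 1 = 0 := by simp [hF]
    linarith

end PoissonAux

/-- Upper bound on the total overlap of two multivariate Poisson distributions with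
mean vectors `ln(n)·c₁` and `ln(n)·c₂`:
`∑_x min{𝒫_{ln(n)c₁}(x) p₁, 𝒫_{ln(n)c₂}(x) p₂} ≤ C n^{-D₊(c₁,c₂)} (ln n)^{-1/2}`. -/
theorem poisson_overlap_upper_bound (k : ℕ) (hk : 0 < k) (c₁ c₂ : Fin k → ℝ)
    (hc₁ : ∀ i, 0 < c₁ i) (hc₂ : ∀ i, 0 < c₂ i) (hne : c₁ ≠ c₂)
    (p₁ p₂ : ℝ) (hp₁ : 0 < p₁) (hp₂ : 0 < p₂) :
    ∃ C : ℝ, ∀ n : ℕ, 2 ≤ n →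
      ∑' x : Fin k → ℕ,
          min (mvPoisson (fun i => Real.log n * c₁ i) x * p₁)
              (mvPoisson (fun i => Real.log n * c₂ i) x * p₂)
        ≤ C * (n : ℝ) ^ (-(Dplus c₁ c₂)) * Real.log n ^ (-(1/2) : ℝ) := by
  obtain ⟨k, rfl⟩ : ∃ k', k = k' + 1 := ⟨k - 1, by omega⟩
  obtain ⟨t, ht0, ht1, hD⟩ := PoissonAux.exists_t c₁ c₂ hc₁ hc₂ hne
  obtain ⟨i, hi⟩ := Function.ne_iff.mp hne
  set D := Dplus c₁ c₂ with hDdef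
  let w : Fin (k + 1) → ℝ := fun i => Real.log (c₁ i) - Real.log (c₂ i)
  let m : Fin (k + 1) → ℝ := fun i => c₁ i ^ t * c₂ i ^ (1 - t)
  have hm : ∀ i, 0 < m i := fun i =>
    mul_pos (Real.rpow_pos_of_pos (hc₁ i) _) (Real.rpow_pos_of_pos (hc₂ i) _)
  have hw : w i ≠ 0 := by
    intro h
    exact hi (Real.log_injOn_pos (hc₁ i) (hc₂ i) (sub_eq_zero.mp h))
  have hm' : ∀ i, m i = Real.exp (Real.log (c₁ i) * t + Real.log (c₂ i) * (1 - t)) := by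
    intro i
    simp only [m]
    rw [Real.rpow_def_of_pos (hc₁ i), Real.rpow_def_of_pos (hc₂ i), ← Real.exp_add]
  have ht1' : 0 < 1 - t := by linarith
  have ha : 0 < min t (1 - t) := lt_min ht0 ht1'
  set a := min t (1 - t) with hadef
  have e1 : ∀ i, c₁ i = m i * Real.exp ((1 - t) * w i) := by
    intro i
    rw [hm', ← Real.exp_add]
    conv_lhs => rw [← Real.exp_log (hc₁ i)]
    congr 1; simp only [w]; ring
  have e2 : ∀ i, c₂ i = m i * Real.exp (-t * w i) := by
    intro i
    rw [hm', ← Real.exp_add]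
    conv_lhs => rw [← Real.exp_log (hc₂ i)]
    congr 1; simp only [w]; ring
  obtain ⟨K, hK⟩ := PoissonAux.anti i w m hm hw a ha
  refine ⟨(p₁ + p₂) * K, ?_⟩
  intro n hn
  have hn1 : (1 : ℝ) < n := by exact_mod_cast hn
  have hL : 0 < Real.log n := Real.log_pos hn1
  set L := Real.log n with hLdef
  set B := L * ∑ i, (c₁ i - c₂ i) with hB
  obtain ⟨hS, hT⟩ := hK L hL B
  have hDsum : D = t * ∑ i, c₁ i + (1 - t) * ∑ i, c₂ i - ∑ i, m i := by
    rw [hD, Finset.sum_sub_distrib, Finset.sum_add_distrib, Finset.mul_sum, Finset.mul_sum]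
  have hP1 : ∀ x, mvPoisson (fun i => L * c₁ i) x = mvPoisson (fun i => L * m i) x *
      (Real.exp (-(L * D)) * Real.exp ((1 - t) * (∑ j, w j * x j - B))) := by
    intro x
    rw [PoissonAux.mvPoisson_tilt L c₁ m _ e1, ← Real.exp_add]
    congr 2
    rw [hDsum, hB, Finset.sum_sub_distrib, Finset.sum_sub_distrib]
    simp only [mul_assoc]
    rw [← Finset.mul_sum]
    ring
  have hP2 : ∀ x, mvPoisson (fun i => L * c₂ i) x = mvPoisson (fun i => L * m i) x *
      (Real.exp (-(L * D)) * Real.exp (-t * (∑ j, w j * x j - B))) := by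
    intro x
    rw [PoissonAux.mvPoisson_tilt L c₂ m _ e2, ← Real.exp_add]
    congr 2
    rw [hDsum, hB, Finset.sum_sub_distrib, Finset.sum_sub_distrib]
    simp only [mul_assoc]
    rw [← Finset.mul_sum]
    ring
  have hpos : ∀ (c : Fin (k + 1) → ℝ), (∀ i, 0 < c i) → ∀ x,
      0 ≤ mvPoisson (fun i => L * c i) x := fun c hc x =>
    Finset.prod_nonneg fun j _ => PoissonAux.pois_nonneg (mul_pos hL (hc j)).le _
  have hle : ∀ x : Fin (k + 1) → ℕ, min (mvPoisson (fun i => L * c₁ i) x * p₁)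
      (mvPoisson (fun i => L * c₂ i) x * p₂) ≤ ((p₁ + p₂) * Real.exp (-(L * D))) *
      (mvPoisson (fun i => L * m i) x * Real.exp (-(a * |∑ j, w j * x j - B|))) := by
    intro x
    have hq := hpos m hm x
    set q := mvPoisson (fun i => L * m i) x
    set r := ∑ j, w j * x j - B
    have hE := Real.exp_pos (-(L * D))
    rcases le_total 0 r with hr | hr
    · refine (min_le_right _ _).trans ?_
      rw [hP2, abs_of_nonneg hr]
      have h1 : Real.exp (-t * r) ≤ Real.exp (-(a * r)) := by
        apply Real.exp_le_exp.mpr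
        have : a ≤ t := min_le_left _ _
        nlinarith
      calc q * (Real.exp (-(L * D)) * Real.exp (-t * r)) * p₂
          ≤ q * (Real.exp (-(L * D)) * Real.exp (-(a * r))) * (p₁ + p₂) := by
            gcongr; linarith
        _ = _ := by ring
    · refine (min_le_left _ _).trans ?_
      rw [hP1, abs_of_nonpos hr]
      have h1 : Real.exp ((1 - t) * r) ≤ Real.exp (-(a * -r)) := by
        apply Real.exp_le_exp.mpr
        have : a ≤ 1 - t := min_le_right _ _
        nlinarith
      calc q * (Real.exp (-(L * D)) * Real.exp ((1 - t) * r)) * p₁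
          ≤ q * (Real.exp (-(L * D)) * Real.exp (-(a * -r))) * (p₁ + p₂) := by
            gcongr; linarith
        _ = _ := by ring
  have hS' := hS.mul_left ((p₁ + p₂) * Real.exp (-(L * D)))
  have hS1 := Summable.of_nonneg_of_le (fun x => le_min
    (mul_nonneg (hpos c₁ hc₁ x) hp₁.le) (mul_nonneg (hpos c₂ hc₂ x) hp₂.le)) hle hS'
  refine (hS1.tsum_le_tsum hle hS').trans ?_
  rw [tsum_mul_left]
  have hnD : (n : ℝ) ^ (-D) = Real.exp (-(L * D)) := by
    rw [Real.rpow_def_of_pos (by linarith)]; congr 1; ring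
  have hLs : L ^ (-(1 / 2) : ℝ) = 1 / √L := by
    rw [Real.rpow_neg hL.le, Real.sqrt_eq_rpow, one_div, one_div]
  rw [hnD, hLs]
  calc (p₁ + p₂) * Real.exp (-(L * D)) * _ ≤ (p₁ + p₂) * Real.exp (-(L * D)) * (K / √L) := by
        gcongr
    _ = _ := by ring
end

section
/- Let (d_n) be a sequence of positive integers with d_n/n³ → ∞ as n → ∞. Then TV(W(n,d_n), M(n,d_n)) → 0 as n → ∞, where TV denotes the total variation distance between the laws of these two random n×n symmetric matrices. -/
open MeasureTheory ProbabilityTheory Filter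
open scoped BigOperators ENNReal Topology

/-- The total variation distance between two measures. -/
noncomputable def tvDist {Ω : Type*} [MeasurableSpace Ω] (μ ν : Measure Ω) : ℝ :=
  ⨆ A : {A : Set Ω // MeasurableSet A}, |(μ A).toReal - (ν A).toReal|

/-- The law of the `n × n` Wishart matrix `W(n,d) = Y Yᵀ`, where `Y` is an `n × d` matrix
of i.i.d. standard Gaussians. -/
noncomputable def wishartLaw (n d : ℕ) : Measure (Fin n → Fin n → ℝ) :=
  Measure.map (fun Y : Fin n → Fin d → ℝ => fun i j => ∑ k, Y i k * Y j k)
    (Measure.pi fun _ : Fin n => Measure.pi fun _ : Fin d => gaussianReal 0 1)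

/-- The law of `M(n,d) = √d · M(n) + d · Iₙ`, where `M(n)` is a GOE matrix: symmetric with
independent `N(0,2)` diagonal entries and `N(0,1)` above-diagonal entries. -/
noncomputable def shiftedGoeLaw (n d : ℕ) : Measure (Fin n → Fin n → ℝ) :=
  Measure.map
    (fun w : (Fin n → ℝ) × ({q : Fin n × Fin n // q.1 < q.2} → ℝ) => fun i j =>
      Real.sqrt d *
          (if i = j then w.1 i
            else if h : i < j then w.2 ⟨(i, j), h⟩
            else if h : j < i then w.2 ⟨(j, i), h⟩ else 0)
        + if i = j then (d : ℝ) else 0)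
    ((Measure.pi fun _ : Fin n => gaussianReal 0 2).prod
      (Measure.pi fun _ : {q : Fin n × Fin n // q.1 < q.2} => gaussianReal 0 1))



/-- Donsker–Varadhan form of `KL(μ ‖ ν) ≤ ε`. -/
def KLle {α : Type*} [MeasurableSpace α] (μ ν : Measure α) (ε : ℝ) : Prop :=
  ∀ g : α → ℝ, Measurable g → (∃ C, ∀ x, |g x| ≤ C) →
    ∫ x, g x ∂μ ≤ ε + Real.log (∫ x, Real.exp (g x) ∂ν)

section kl
set_option linter.unusedSectionVars false
variable {α β Ω Ω' : Type*} [MeasurableSpace α] [MeasurableSpace β] [MeasurableSpace Ω]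
  [MeasurableSpace Ω']

lemma integrable_of_bdd {μ : Measure α} [IsFiniteMeasure μ] {g : α → ℝ} (hg : Measurable g)
    {C : ℝ} (hC : ∀ x, |g x| ≤ C) : Integrable g μ :=
  Integrable.of_bound hg.aestronglyMeasurable C (ae_of_all _ hC)

lemma exp_bdd {g : α → ℝ} {C : ℝ} (hC : ∀ x, |g x| ≤ C) (x : α) :
    |Real.exp (g x)| ≤ Real.exp C := by
  rw [abs_of_pos (Real.exp_pos _)]
  exact Real.exp_le_exp.2 ((le_abs_self _).trans (hC x))

lemma integrable_exp_of_bdd {μ : Measure α} [IsFiniteMeasure μ] {g : α → ℝ} (hg : Measurable g)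
    {C : ℝ} (hC : ∀ x, |g x| ≤ C) : Integrable (fun x => Real.exp (g x)) μ :=
  integrable_of_bdd hg.exp (exp_bdd hC)

lemma exp_neg_le_integral_exp {μ : Measure α} [IsProbabilityMeasure μ] {g : α → ℝ}
    (hg : Measurable g) {C : ℝ} (hC : ∀ x, |g x| ≤ C) :
    Real.exp (-C) ≤ ∫ x, Real.exp (g x) ∂μ := by
  have : ∫ x, Real.exp (-C) ∂μ ≤ ∫ x, Real.exp (g x) ∂μ :=
    integral_mono (integrable_const _) (integrable_exp_of_bdd hg hC)
      (fun x => Real.exp_le_exp.2 (abs_le.1 (hC x)).1)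
  simpa using this

lemma integral_exp_le {μ : Measure α} [IsProbabilityMeasure μ] {g : α → ℝ}
    (hg : Measurable g) {C : ℝ} (hC : ∀ x, |g x| ≤ C) :
    ∫ x, Real.exp (g x) ∂μ ≤ Real.exp C := by
  have : ∫ x, Real.exp (g x) ∂μ ≤ ∫ x, Real.exp C ∂μ :=
    integral_mono (integrable_exp_of_bdd hg hC) (integrable_const _)
      (fun x => Real.exp_le_exp.2 (abs_le.1 (hC x)).2)
  simpa using this

lemma log_integral_exp_bdd {μ : Measure α} [IsProbabilityMeasure μ] {g : α → ℝ}
    (hg : Measurable g) {C : ℝ} (hC : ∀ x, |g x| ≤ C) :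
    |Real.log (∫ x, Real.exp (g x) ∂μ)| ≤ C := by
  have h1 := exp_neg_le_integral_exp (μ := μ) hg hC
  have h2 := integral_exp_le (μ := μ) hg hC
  have h0 : 0 < ∫ x, Real.exp (g x) ∂μ := (Real.exp_pos _).trans_le h1
  rw [abs_le]
  exact ⟨(Real.le_log_iff_exp_le h0).2 h1, (Real.log_le_iff_le_exp h0).2 h2⟩

lemma KLle.mono {μ ν : Measure α} {ε ε' : ℝ} (h : KLle μ ν ε) (hε : ε ≤ ε') : KLle μ ν ε' := by
  intro g hg hC
  linarith [h g hg hC]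

lemma KLle.map {μ ν : Measure α} {ε : ℝ} (h : KLle μ ν ε) {f : α → β} (hf : Measurable f) :
    KLle (μ.map f) (ν.map f) ε := by
  intro g hg hC
  rw [integral_map hf.aemeasurable hg.aestronglyMeasurable,
    integral_map hf.aemeasurable hg.exp.aestronglyMeasurable]
  obtain ⟨C, hC⟩ := hC
  exact h _ (hg.comp hf) ⟨C, fun x => hC _⟩

lemma KLle.chain {P : Measure Ω} {P' : Measure Ω'} {ν₁ : Measure α} {ν₂ : Measure β}
    [IsProbabilityMeasure P] [IsProbabilityMeasure P'] [IsProbabilityMeasure ν₁]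
    [IsProbabilityMeasure ν₂] {X : Ω → α} (hXm : Measurable X) {Z : Ω × Ω' → β}
    (hZm : Measurable Z) {ε₁ : ℝ} {e : Ω → ℝ} (hX : KLle (P.map X) ν₁ ε₁)
    (hZ : ∀ᵐ ω ∂P, KLle (P'.map (fun ω' => Z (ω, ω'))) ν₂ (e ω)) (he : Integrable e P) :
    KLle ((P.prod P').map (fun p => (X p.1, Z p))) (ν₁.prod ν₂) (ε₁ + ∫ ω, e ω ∂P) := by
  rintro g hg ⟨C, hC⟩
  set G : α → ℝ := fun x => Real.log (∫ z, Real.exp (g (x, z)) ∂ν₂) with hG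
  have hGm : Measurable G := by
    apply Real.measurable_log.comp
    exact (StronglyMeasurable.integral_prod_right (f := fun x z => Real.exp (g (x, z)))
      hg.exp.stronglyMeasurable).measurable
  have hGb : ∀ x, |G x| ≤ C := fun x =>
    log_integral_exp_bdd (hg.comp measurable_prodMk_left) (fun z => hC (x, z))
  have hm : Measurable (fun p : Ω × Ω' => (X p.1, Z p)) := (hXm.comp measurable_fst).prodMk hZm
  have hgi : Integrable (fun p : Ω × Ω' => g (X p.1, Z p)) (P.prod P') :=
    integrable_of_bdd (hg.comp hm) (fun x => hC _)
  rw [integral_map hm.aemeasurable hg.aestronglyMeasurable, integral_prod _ hgi]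
  have hint2 : Integrable (fun ω => G (X ω)) P := integrable_of_bdd (hGm.comp hXm) (fun x => hGb _)
  have step1 : ∫ ω, ∫ ω', g (X ω, Z (ω, ω')) ∂P' ∂P ≤ ∫ ω, (e ω + G (X ω)) ∂P := by
    apply integral_mono_ae _ (he.add hint2)
    · filter_upwards [hZ] with ω hω
      have := hω (fun z => g (X ω, z)) (hg.comp measurable_prodMk_left) ⟨C, fun z => hC _⟩
      have hgx : Measurable (fun z => g (X ω, z)) := hg.comp measurable_prodMk_left
      have hZx : Measurable (fun ω' => Z (ω, ω')) := hZm.comp measurable_prodMk_left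
      rw [integral_map hZx.aemeasurable hgx.aestronglyMeasurable] at this
      exact this
    · exact hgi.integral_prod_left
  rw [integral_add he hint2] at step1
  have step2 := hX G hGm ⟨C, hGb⟩
  rw [integral_map hXm.aemeasurable hGm.aestronglyMeasurable] at step2
  have step3 : ∫ x, Real.exp (G x) ∂ν₁ = ∫ p, Real.exp (g p) ∂(ν₁.prod ν₂) := by
    rw [integral_prod _ (integrable_exp_of_bdd hg hC)]
    congr 1
    ext x
    rw [hG]
    exact Real.exp_log ((Real.exp_pos _).trans_le
      (exp_neg_le_integral_exp (hg.comp measurable_prodMk_left) (fun z => hC (x, z))))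
  rw [step3] at step2
  linarith

lemma KLle.gibbs {μ ν : Measure α} [IsProbabilityMeasure μ] [IsProbabilityMeasure ν]
    {φ : α → ℝ} (hφ : Integrable φ μ)
    (H : ∀ h : α → ℝ≥0∞, Measurable h →
      ∫⁻ x, h x * ENNReal.ofReal (Real.exp (-φ x)) ∂μ ≤ ∫⁻ x, h x ∂ν) :
    KLle μ ν (∫ x, φ x ∂μ) := by
  rintro g hg ⟨C, hC⟩
  set c := Real.log (∫ x, Real.exp (g x) ∂ν) with hc
  have hpos : 0 < ∫ x, Real.exp (g x) ∂ν :=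
    (Real.exp_pos _).trans_le (exp_neg_le_integral_exp hg hC)
  have hgi : Integrable g μ := integrable_of_bdd hg hC
  have hae : AEStronglyMeasurable (fun x => Real.exp (g x - φ x - c)) μ :=
    Real.continuous_exp.comp_aestronglyMeasurable
      ((hgi.aestronglyMeasurable.sub hφ.aestronglyMeasurable).sub aestronglyMeasurable_const)
  have hL : ∫⁻ x, ENNReal.ofReal (Real.exp (g x - φ x - c)) ∂μ ≤ 1 := by
    calc ∫⁻ x, ENNReal.ofReal (Real.exp (g x - φ x - c)) ∂μ
        = ∫⁻ x, ENNReal.ofReal (Real.exp (g x - c)) * ENNReal.ofReal (Real.exp (-φ x)) ∂μ := by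
          congr 1; ext x
          rw [← ENNReal.ofReal_mul (Real.exp_pos _).le, ← Real.exp_add]
          congr 2; ring
      _ ≤ ∫⁻ x, ENNReal.ofReal (Real.exp (g x - c)) ∂ν := H _ (by fun_prop)
      _ = ENNReal.ofReal (∫ x, Real.exp (g x - c) ∂ν) := by
          rw [ofReal_integral_eq_lintegral_ofReal]
          · simp_rw [Real.exp_sub]
            exact (integrable_exp_of_bdd hg hC).div_const _
          · exact ae_of_all _ (fun x => (Real.exp_pos _).le)
      _ = 1 := by
          simp_rw [Real.exp_sub]
          rw [integral_div, hc, Real.exp_log hpos, div_self hpos.ne', ENNReal.ofReal_one]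
  have hgint : Integrable (fun x => Real.exp (g x - φ x - c)) μ := by
    refine ⟨hae, ?_⟩
    rw [hasFiniteIntegral_iff_ofReal (ae_of_all _ (fun x => (Real.exp_pos _).le))]
    exact hL.trans_lt ENNReal.one_lt_top
  have hI : ∫ x, Real.exp (g x - φ x - c) ∂μ ≤ 1 := by
    rw [integral_eq_lintegral_of_nonneg_ae (ae_of_all _ (fun x => (Real.exp_pos _).le)) hae]
    exact ENNReal.toReal_le_of_le_ofReal zero_le_one (by simpa using hL)
  have key : ∫ x, (g x - φ x - c) ∂μ ≤ ∫ x, (Real.exp (g x - φ x - c) - 1) ∂μ :=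
    integral_mono ((hgi.sub hφ).sub (integrable_const _)) (hgint.sub (integrable_const _))
      (fun x => by have := Real.add_one_le_exp (g x - φ x - c); simp only; linarith)
  have hsub : Integrable (fun x => g x - φ x) μ := hgi.sub hφ
  rw [integral_sub hsub (integrable_const _), integral_sub hgi hφ,
    integral_sub hgint (integrable_const _)] at key
  simp at key
  linarith

lemma KLle.le_add {μ ν : Measure α} [IsProbabilityMeasure μ] [IsProbabilityMeasure ν] {t : ℝ}
    (ht : 0 < t) (ht1 : t ≤ 1) (h : KLle μ ν (t ^ 2)) {A : Set α} (hA : MeasurableSet A) :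
    μ.real A ≤ ν.real A + 2 * t := by
  have h1 := h (A.indicator (fun _ => t)) (measurable_const.indicator hA) ⟨t, fun x => by
    by_cases hx : x ∈ A <;> simp [hx, abs_of_pos ht, ht.le]⟩
  rw [integral_indicator_const _ hA] at h1
  have h2 : ∫ x, Real.exp (A.indicator (fun _ => t) x) ∂ν = 1 + ν.real A * (Real.exp t - 1) := by
    have : ∀ x, Real.exp (A.indicator (fun _ => t) x) =
        1 + A.indicator (fun _ => Real.exp t - 1) x := by
      intro x
      by_cases hx : x ∈ A <;> simp [hx]
    simp_rw [this]
    rw [integral_add (integrable_const _) ((integrable_const _).indicator hA),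
      integral_indicator_const _ hA]
    simp
  rw [h2] at h1
  have hν0 : 0 ≤ ν.real A := measureReal_nonneg
  have hν1 : ν.real A ≤ 1 := measureReal_le_one
  have he : Real.exp t - 1 ≤ t + t ^ 2 := by
    have := Real.abs_exp_sub_one_sub_id_le (x := t) (by rw [abs_of_pos ht]; exact ht1)
    linarith [(abs_le.1 this).2]
  have he0 : 0 < Real.exp t - 1 := by linarith [Real.add_one_le_exp t]
  have hlog := Real.log_le_sub_one_of_pos (x := 1 + ν.real A * (Real.exp t - 1)) (by positivity)
  simp only [smul_eq_mul] at h1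
  have : t * μ.real A ≤ t * (ν.real A + 2 * t) := by nlinarith
  exact le_of_mul_le_mul_left this ht

lemma KLle.tv {μ ν : Measure α} [IsProbabilityMeasure μ] [IsProbabilityMeasure ν] {t : ℝ}
    (ht : 0 < t) (ht1 : t ≤ 1) (h : KLle μ ν (t ^ 2)) : tvDist μ ν ≤ 2 * t := by
  unfold tvDist
  apply Real.iSup_le _ (by positivity)
  rintro ⟨A, hA⟩
  have h1 := h.le_add ht ht1 hA
  have h2 := h.le_add ht ht1 hA.compl
  rw [probReal_compl_eq_one_sub hA, probReal_compl_eq_one_sub hA] at h2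
  simp only [Measure.real] at h1 h2
  rw [abs_le]
  constructor <;> simp only <;> linarith

lemma tvDist_nonneg (μ ν : Measure α) : 0 ≤ tvDist μ ν :=
  Real.iSup_nonneg (fun _ => abs_nonneg _)

end kl

lemma KLle.pi {n : ℕ} {μ ν : Fin n → Measure ℝ} [∀ i, IsProbabilityMeasure (μ i)]
    [∀ i, IsProbabilityMeasure (ν i)] {ε : Fin n → ℝ} (h : ∀ i, KLle (μ i) (ν i) (ε i)) :
    KLle (Measure.pi μ) (Measure.pi ν) (∑ i, ε i) := by
  induction n with
  | zero =>
    have : Measure.pi μ = Measure.pi ν := by congr 1; ext i; exact i.elim0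
    rw [this]
    rintro g hg ⟨C, hC⟩
    have : ∀ x, g x = g default := fun x => congrArg g (Subsingleton.elim _ _)
    simp_rw [this]
    simp
  | succ n ih =>
    have h1 := ih (μ := fun i => μ i.succ) (ν := fun i => ν i.succ) (fun i => h i.succ)
    have hc := KLle.chain (P := μ 0) (P' := Measure.pi (fun i : Fin n => μ i.succ)) (X := id)
      (Z := Prod.snd) measurable_id measurable_snd (ν₁ := ν 0) (ε₁ := ε 0)
      (ν₂ := Measure.pi (fun i : Fin n => ν i.succ)) (e := fun _ => ∑ i : Fin n, ε i.succ)
      (by simpa using h 0) (ae_of_all _ (fun _ => by simpa using h1)) (integrable_const _)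
    have hid : (fun p : ℝ × (Fin n → ℝ) => (id p.1, p.2)) = id := rfl
    rw [hid, Measure.map_id] at hc
    have hm := hc.map (MeasurableEquiv.piFinSuccAbove (fun _ => ℝ) 0).symm.measurable
    have e1 := (measurePreserving_piFinSuccAbove μ 0).symm.map_eq
    have e2 := (measurePreserving_piFinSuccAbove ν 0).symm.map_eq
    simp only [Fin.succAbove_zero] at e1 e2
    rw [e1, e2] at hm
    rw [Fin.sum_univ_succ]
    simpa using hm


open scoped NNReal in
lemma KLle_gaussian (a b : ℝ) {v w : ℝ≥0} (hv : v ≠ 0) (hw : w ≠ 0) :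
    KLle (gaussianReal a v) (gaussianReal b w)
      ((Real.log w - Real.log v) / 2 + (v + (a - b) ^ 2) / (2 * w) - 1 / 2) := by
  have hv' : (0 : ℝ) < v := by positivity
  have hw' : (0 : ℝ) < w := by positivity
  have hid : MemLp (fun x : ℝ => x) 2 (gaussianReal a v) := memLp_id_gaussianReal 2
  have hi1 : Integrable (fun x : ℝ => x) (gaussianReal a v) :=
    hid.integrable (by norm_num)
  have hi2 : Integrable (fun x : ℝ => x ^ 2) (gaussianReal a v) := hid.integrable_sq
  have hE1 : ∫ x, x ∂(gaussianReal a v) = a := integral_id_gaussianReal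
  have hE2 : ∫ x, x ^ 2 ∂(gaussianReal a v) = v + a ^ 2 := by
    have := variance_fun_id_gaussianReal (μ := a) (v := v)
    rw [variance_eq_sub hid] at this
    simp only [Pi.pow_apply, hE1] at this
    linarith
  set φ : ℝ → ℝ := fun x => (Real.log w - Real.log v) / 2 + (x - b) ^ 2 / (2 * w)
    - (x - a) ^ 2 / (2 * v) with hφ
  have hφ2 : φ = fun x => ((1 / (2 * w) - 1 / (2 * v)) * x ^ 2 + (a / v - b / w) * x)
      + ((Real.log w - Real.log v) / 2 + b ^ 2 / (2 * w) - a ^ 2 / (2 * v)) := by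
    ext x; simp only [hφ]; field_simp; ring
  have hii : Integrable (fun x : ℝ => (1 / (2 * w) - 1 / (2 * v)) * x ^ 2 + (a / v - b / w) * x)
    (gaussianReal a v) := (hi2.const_mul _).add (hi1.const_mul _)
  have hφi : Integrable φ (gaussianReal a v) := by
    rw [hφ2]
    exact hii.add (integrable_const _)
  have hφE : ∫ x, φ x ∂(gaussianReal a v) =
      (Real.log w - Real.log v) / 2 + (v + (a - b) ^ 2) / (2 * w) - 1 / 2 := by
    rw [hφ2, integral_add hii (integrable_const _),
      integral_add (hi2.const_mul _) (hi1.const_mul _), integral_const_mul, integral_const_mul,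
      hE1, hE2]
    simp
    field_simp
    ring
  rw [← hφE]
  apply KLle.gibbs hφi
  intro h hh
  have hφm : Measurable φ := by rw [hφ]; fun_prop
  rw [gaussianReal_of_var_ne_zero a hv, gaussianReal_of_var_ne_zero b hw,
    lintegral_withDensity_eq_lintegral_mul _ (measurable_gaussianPDF _ _) (by fun_prop),
    lintegral_withDensity_eq_lintegral_mul _ (measurable_gaussianPDF _ _) hh]
  apply le_of_eq
  congr 1
  ext x
  simp only [Pi.mul_apply]
  have : gaussianPDF b w x = gaussianPDF a v x * ENNReal.ofReal (Real.exp (-φ x)) := by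
    simp only [gaussianPDF]
    rw [← ENNReal.ofReal_mul (gaussianPDFReal_nonneg _ _ _)]
    congr 1
    simp only [gaussianPDFReal, hφ]
    have e1 : √(2 * Real.pi * w) = Real.exp (Real.log (2 * Real.pi) / 2 + Real.log w / 2) := by
      rw [← add_div, ← Real.log_mul (by positivity) hw'.ne', ← Real.log_sqrt (by positivity),
        Real.exp_log (by positivity)]
    have e2 : √(2 * Real.pi * v) = Real.exp (Real.log (2 * Real.pi) / 2 + Real.log v / 2) := by
      rw [← add_div, ← Real.log_mul (by positivity) hv'.ne', ← Real.log_sqrt (by positivity),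
        Real.exp_log (by positivity)]
    rw [e1, e2, ← Real.exp_neg, ← Real.exp_neg, ← Real.exp_add, ← Real.exp_add, ← Real.exp_add]
    congr 1
    field_simp
    ring
  rw [this]
  ring

/-- standard Gaussian measure on `Fin m → ℝ` -/
noncomputable abbrev gam (m : ℕ) : Measure (Fin m → ℝ) :=
  Measure.pi fun _ : Fin m => gaussianReal 0 1

lemma gam_density (m : ℕ) : gam m = (volume : Measure (Fin m → ℝ)).withDensity
    (fun x => ENNReal.ofReal (∏ i, gaussianPDFReal 0 1 (x i))) := by
  symm
  refine (Measure.pi_eq (fun s hs => ?_)).symm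
  rw [withDensity_apply _ (MeasurableSet.univ_pi hs)]
  rw [← lintegral_indicator (MeasurableSet.univ_pi hs)]
  have h1 : ∀ x : Fin m → ℝ, (Set.univ.pi s).indicator
      (fun x => ENNReal.ofReal (∏ i, gaussianPDFReal 0 1 (x i))) x =
      ENNReal.ofReal (∏ i, (s i).indicator (gaussianPDFReal 0 1) (x i)) := by
    intro x
    by_cases hx : x ∈ Set.univ.pi s
    · rw [Set.indicator_of_mem hx]
      congr 1
      refine Finset.prod_congr rfl (fun i _ => ?_)
      rw [Set.indicator_of_mem (hx i trivial)]
    · rw [Set.indicator_of_notMem hx]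
      simp only [Set.mem_pi, Set.mem_univ, forall_const, not_forall] at hx
      obtain ⟨i, hi⟩ := hx
      rw [Finset.prod_eq_zero (Finset.mem_univ i), ENNReal.ofReal_zero]
      exact Set.indicator_of_notMem hi _
  simp_rw [h1]
  have hI : ∀ i, Integrable ((s i).indicator (gaussianPDFReal 0 1)) :=
    fun i => (integrable_gaussianPDFReal 0 1).indicator (hs i)
  have hnn : ∀ i x, 0 ≤ (s i).indicator (gaussianPDFReal 0 1) x :=
    fun i x => Set.indicator_nonneg (fun _ _ => gaussianPDFReal_nonneg _ _ _) _
  rw [volume_pi, ← ofReal_integral_eq_lintegral_ofReal (Integrable.fintype_prod hI)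
    (ae_of_all _ (fun x => Finset.prod_nonneg (fun i _ => hnn _ _)))]
  rw [integral_fintype_prod_eq_prod, ENNReal.ofReal_prod_of_nonneg
    (fun i _ => integral_nonneg (hnn i))]
  refine Finset.prod_congr rfl (fun i _ => ?_)
  rw [gaussianReal_apply_eq_integral _ one_ne_zero, integral_indicator (hs i)]

lemma prod_gaussianPDF (m : ℕ) (x : Fin m → ℝ) : ∏ i, gaussianPDFReal 0 1 (x i) =
    (√(2 * Real.pi))⁻¹ ^ m * Real.exp (-(∑ i, x i ^ 2) / 2) := by
  simp only [gaussianPDFReal]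
  rw [Finset.prod_mul_distrib, ← Real.exp_sum]
  simp [Finset.sum_div, neg_div]

lemma gam_integral_sq (m : ℕ) :
    ∃ C : ℝ, ∀ f : ℝ → ℝ, ∫ x, f (∑ i, x i ^ 2) ∂(gam (m + 1)) =
      C * ∫ t in Set.Ioi (0 : ℝ), t ^ (((m + 1 : ℕ) : ℝ) / 2 - 1) * Real.exp (-(1 / 2 * t)) * f t := by
  refine ⟨((√(2 * Real.pi))⁻¹ ^ (m + 1)) * ((m + 1 : ℕ) * (volume : Measure (EuclideanSpace ℝ (Fin (m + 1)))).real (Metric.ball 0 1)) / 2, fun f => ?_⟩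
  rw [gam_density, integral_withDensity_eq_integral_toReal_smul]
  rotate_left
  · fun_prop
  · exact ae_of_all _ (fun x => ENNReal.ofReal_lt_top)
  have h1 : ∀ x : Fin (m + 1) → ℝ,
      (ENNReal.ofReal (∏ i, gaussianPDFReal 0 1 (x i))).toReal • f (∑ i, x i ^ 2) =
      (√(2 * Real.pi))⁻¹ ^ (m + 1) * (Real.exp (-(∑ i, x i ^ 2) / 2) * f (∑ i, x i ^ 2)) := by
    intro x
    rw [ENNReal.toReal_ofReal (Finset.prod_nonneg (fun i _ => gaussianPDFReal_nonneg _ _ _)),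
      prod_gaussianPDF, smul_eq_mul, mul_assoc]
  simp_rw [h1]
  rw [integral_const_mul]
  have h2 : ∫ x : Fin (m + 1) → ℝ, Real.exp (-(∑ i, x i ^ 2) / 2) * f (∑ i, x i ^ 2) =
      ∫ x : EuclideanSpace ℝ (Fin (m + 1)), (fun r => Real.exp (-(r ^ 2) / 2) * f (r ^ 2)) ‖x‖ := by
    rw [← (PiLp.volume_preserving_ofLp (Fin (m + 1))).integral_comp
      (MeasurableEquiv.toLp 2 (Fin (m + 1) → ℝ)).symm.measurableEmbedding]
    refine integral_congr_ae (ae_of_all _ (fun x => ?_))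
    simp only [EuclideanSpace.real_norm_sq_eq]
  rw [h2, integral_fun_norm_addHaar (volume : Measure (EuclideanSpace ℝ (Fin (m + 1))))
    (fun r => Real.exp (-(r ^ 2) / 2) * f (r ^ 2))]
  rw [← integral_comp_rpow_Ioi_of_pos (p := 2) (by norm_num) (g := fun t => t ^ (((m + 1 : ℕ) : ℝ) / 2 - 1) * Real.exp (-(1 / 2 * t)) * f t)]
  have h3 : Module.finrank ℝ (EuclideanSpace ℝ (Fin (m + 1))) = m + 1 := by simp
  rw [h3]
  have h4 : ∫ x in Set.Ioi (0 : ℝ), (2 * x ^ ((2 : ℝ) - 1)) • ((x ^ (2 : ℝ)) ^ (((m + 1 : ℕ) : ℝ) / 2 - 1)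
      * Real.exp (-(1 / 2 * x ^ (2 : ℝ))) * f (x ^ (2 : ℝ))) =
      2 * ∫ x in Set.Ioi (0 : ℝ), x ^ (m + 1 - 1) • (Real.exp (-(x ^ 2) / 2) * f (x ^ 2)) := by
    rw [← integral_const_mul]
    refine setIntegral_congr_fun measurableSet_Ioi (fun x hx => ?_)
    have hx' : (0 : ℝ) < x := hx
    simp only [smul_eq_mul, Real.rpow_two]
    have : (x ^ 2) ^ (((m + 1 : ℕ) : ℝ) / 2 - 1) * x = x ^ m := by
      rw [← Real.rpow_two, ← Real.rpow_mul hx'.le, ← Real.rpow_natCast]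
      nth_rewrite 2 [← Real.rpow_one x]
      rw [← Real.rpow_add hx']
      congr 1
      push_cast
      ring
    rw [show (2 : ℝ) - 1 = 1 by norm_num, Real.rpow_one, Nat.add_sub_cancel, ← this]
    ring_nf
  rw [h4]
  simp only [smul_eq_mul, nsmul_eq_mul]
  ring

lemma measurable_gammaPDF' (a r : ℝ) : Measurable (gammaPDF a r) :=
  (measurable_gammaPDFReal a r).ennreal_ofReal

lemma map_sq_gam {m : ℕ} (hm : 0 < m) :
    (gam m).map (fun x => ∑ i, x i ^ 2) = gammaMeasure ((m : ℝ) / 2) (1 / 2) := by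
  obtain ⟨m, rfl⟩ : ∃ k, m = k + 1 := ⟨m - 1, by omega⟩
  obtain ⟨C, hC⟩ := gam_integral_sq m
  have ha : (0 : ℝ) < ((m + 1 : ℕ) : ℝ) / 2 := by positivity
  have hr : (0 : ℝ) < 1 / 2 := by norm_num
  set a := ((m + 1 : ℕ) : ℝ) / 2 with haa
  have hC1 : C * ((1 / (1 / 2 : ℝ)) ^ a * Real.Gamma a) = 1 := by
    have := hC (fun _ => 1)
    simp only [mul_one] at this
    rw [Real.integral_rpow_mul_exp_neg_mul_Ioi ha hr] at this
    rw [← this]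
    simp
  have hC2 : C = (1 / 2 : ℝ) ^ a / Real.Gamma a := by
    have hG := Real.Gamma_pos_of_pos ha
    rw [one_div_one_div] at hC1
    rw [Real.div_rpow zero_le_one zero_le_two, Real.one_rpow]
    have h2 : (0 : ℝ) < 2 ^ a := by positivity
    field_simp
    linarith
  have := isProbabilityMeasure_gammaMeasure ha hr
  have hmeas : Measurable (fun x : Fin (m + 1) → ℝ => ∑ i, x i ^ 2) := by fun_prop
  have := Measure.isProbabilityMeasure_map (μ := gam (m + 1)) hmeas.aemeasurable
  ext s hs
  rw [← ENNReal.toReal_eq_toReal_iff' (measure_ne_top _ _) (measure_ne_top _ _)]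
  change ((gam (m + 1)).map (fun x => ∑ i, x i ^ 2)).real s = (gammaMeasure a (1 / 2)).real s
  rw [← integral_indicator_one hs, integral_map hmeas.aemeasurable
    ((measurable_one.indicator hs).aestronglyMeasurable), hC, hC2,
    ← integral_indicator_one hs, gammaMeasure, integral_withDensity_eq_integral_toReal_smul
    (measurable_gammaPDF' _ _) (ae_of_all _ (fun x => ENNReal.ofReal_lt_top)),
    ← integral_const_mul, ← integral_indicator measurableSet_Ioi]
  apply integral_congr_ae
  have h0 : ∀ᵐ x : ℝ, x ≠ 0 := by simp [ae_iff]
  filter_upwards [h0] with x hx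
  rw [gammaPDF, ENNReal.toReal_ofReal (gammaPDFReal_nonneg ha hr _)]
  rcases lt_or_gt_of_ne hx with h | h
  · rw [Set.indicator_of_notMem (by simp [h.le])]
    simp [gammaPDFReal, not_le.2 h]
  · rw [Set.indicator_of_mem (by simpa using h)]
    simp only [gammaPDFReal, if_pos h.le, smul_eq_mul]
    ring


lemma log_le_cubic {u : ℝ} (hu : 0 < u) :
    Real.log u ≤ (u - 1) - (u - 1) ^ 2 / 2 + (u - 1) ^ 3 / 3 := by
  set f : ℝ → ℝ := fun u => (u - 1) - (u - 1) ^ 2 / 2 + (u - 1) ^ 3 / 3 - Real.log u with hf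
  have hd : ∀ x, 0 < x → HasDerivAt f ((x - 1) ^ 3 / x) x := by
    intro x hx
    have h1 : HasDerivAt (fun u : ℝ => u - 1) 1 x := (hasDerivAt_id x).sub_const 1
    have := ((h1.sub ((h1.pow 2).div_const 2)).add ((h1.pow 3).div_const 3)).sub
      (Real.hasDerivAt_log hx.ne')
    refine this.congr_deriv ?_
    field_simp
    push_cast
    ring
  have hc : ∀ x, 0 < x → ContinuousAt f x := fun x hx => (hd x hx).continuousAt
  have hf1 : f 1 = 0 := by simp [hf]
  suffices 0 ≤ f u by simp only [hf] at this; linarith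
  rcases le_total 1 u with h | h
  · have : MonotoneOn f (Set.Ici 1) := by
      apply monotoneOn_of_deriv_nonneg (convex_Ici 1)
      · intro x hx; exact (hc x (by simp at hx; linarith)).continuousWithinAt
      · intro x hx
        simp at hx
        exact (hd x (by linarith)).differentiableAt.differentiableWithinAt
      · intro x hx
        simp at hx
        rw [(hd x (by linarith)).deriv]
        have : 0 ≤ x - 1 := by linarith
        positivity
    rw [← hf1]
    exact this (by simp) h h
  · have : AntitoneOn f (Set.Ioc 0 1) := by
      apply antitoneOn_of_deriv_nonpos (convex_Ioc 0 1)
      · intro x hx; exact (hc x hx.1).continuousWithinAt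
      · intro x hx
        simp at hx
        exact (hd x hx.1).differentiableAt.differentiableWithinAt
      · intro x hx
        simp at hx
        rw [(hd x hx.1).deriv]
        apply div_nonpos_of_nonpos_of_nonneg _ hx.1.le
        have : (1 - x) ^ 3 ≥ 0 := by have : 0 ≤ 1 - x := by linarith
                                     positivity
        nlinarith
    rw [← hf1]
    exact this ⟨hu, h⟩ ⟨one_pos, le_rfl⟩ h

lemma gamma_ae_pos {a : ℝ} (ha : 0 < a) : ∀ᵐ t ∂(gammaMeasure a (1 / 2)), 0 < t := by
  rw [ae_iff, gammaMeasure, withDensity_apply _ (by measurability)]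
  have : {t : ℝ | ¬ 0 < t} = Set.Iic 0 := by ext; simp
  rw [this, ← setLIntegral_congr (Iio_ae_eq_Iic (a := (0 : ℝ)))]
  exact lintegral_gammaPDF_of_nonpos le_rfl

lemma gamma_rpow_aux {a : ℝ} (ha : 0 < a) (s : ℝ) :
    (fun t => gammaPDFReal a (1 / 2) t * t ^ s) =ᵐ[volume] (Set.Ioi (0 : ℝ)).indicator
      (fun t => (1 / 2 : ℝ) ^ a / Real.Gamma a * (t ^ (a + s - 1) * Real.exp (-(1 / 2 * t)))) := by
  have h0 : ∀ᵐ x : ℝ, x ≠ 0 := by simp [ae_iff]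
  filter_upwards [h0] with x hx
  rcases lt_or_gt_of_ne hx with h | h
  · rw [Set.indicator_of_notMem (by simp [h.le])]
    simp [gammaPDFReal, not_le.2 h]
  · rw [Set.indicator_of_mem (by simpa using h)]
    simp only [gammaPDFReal, if_pos h.le]
    rw [show a + s - 1 = (a - 1) + s by ring, Real.rpow_add h]
    ring

lemma gamma_rpow_integrable {a : ℝ} (ha : 0 < a) {s : ℝ} (hs : 0 < a + s) :
    Integrable (fun t : ℝ => t ^ s) (gammaMeasure a (1 / 2)) := by
  rw [gammaMeasure, integrable_withDensity_iff_integrable_smul' (measurable_gammaPDF' _ _)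
    (ae_of_all _ (fun x => ENNReal.ofReal_lt_top))]
  have : (fun t : ℝ => (gammaPDF a (1 / 2) t).toReal • t ^ s) =
      fun t => gammaPDFReal a (1 / 2) t * t ^ s := by
    ext t
    rw [gammaPDF, ENNReal.toReal_ofReal (gammaPDFReal_nonneg ha (by norm_num) _), smul_eq_mul]
  rw [this]
  refine Integrable.congr ?_ (gamma_rpow_aux ha s).symm
  rw [integrable_indicator_iff measurableSet_Ioi]
  apply Integrable.const_mul
  have hne : ∫ t in Set.Ioi (0 : ℝ), t ^ (a + s - 1) * Real.exp (-(1 / 2 * t)) ≠ 0 := by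
    rw [Real.integral_rpow_mul_exp_neg_mul_Ioi hs (by norm_num)]
    have := Real.Gamma_pos_of_pos hs
    positivity
  by_contra hni
  exact hne (integral_undef hni)

lemma gamma_rpow_integral {a : ℝ} (ha : 0 < a) {s : ℝ} (hs : 0 < a + s) :
    ∫ t, t ^ s ∂(gammaMeasure a (1 / 2)) = 2 ^ s * Real.Gamma (a + s) / Real.Gamma a := by
  rw [gammaMeasure, integral_withDensity_eq_integral_toReal_smul (measurable_gammaPDF' _ _)
    (ae_of_all _ (fun x => ENNReal.ofReal_lt_top))]
  have : (fun t : ℝ => (gammaPDF a (1 / 2) t).toReal • t ^ s) =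
      fun t => gammaPDFReal a (1 / 2) t * t ^ s := by
    ext t
    rw [gammaPDF, ENNReal.toReal_ofReal (gammaPDFReal_nonneg ha (by norm_num) _), smul_eq_mul]
  rw [this, integral_congr_ae (gamma_rpow_aux ha s), integral_indicator measurableSet_Ioi,
    integral_const_mul, Real.integral_rpow_mul_exp_neg_mul_Ioi hs (by norm_num), one_div_one_div,
    Real.rpow_add two_pos, Real.div_rpow zero_le_one zero_le_two, Real.one_rpow]
  have h2 : (0 : ℝ) < 2 ^ a := by positivity
  field_simp

lemma gamma_m1 {a : ℝ} (ha : 0 < a) : Integrable (fun t : ℝ => t) (gammaMeasure a (1 / 2)) ∧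
    ∫ t, t ∂(gammaMeasure a (1 / 2)) = 2 * a := by
  have h := gamma_rpow_integrable ha (s := 1) (by linarith)
  have h' := gamma_rpow_integral ha (s := 1) (by linarith)
  simp only [Real.rpow_one] at h h'
  refine ⟨h, ?_⟩
  rw [h', Real.Gamma_add_one ha.ne']
  have := Real.Gamma_pos_of_pos ha
  field_simp

lemma gamma_m2 {a : ℝ} (ha : 0 < a) : Integrable (fun t : ℝ => t ^ 2) (gammaMeasure a (1 / 2)) ∧
    ∫ t, t ^ 2 ∂(gammaMeasure a (1 / 2)) = 4 * a * (a + 1) := by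
  have h := gamma_rpow_integrable ha (s := 2) (by linarith)
  have h' := gamma_rpow_integral ha (s := 2) (by linarith)
  simp only [Real.rpow_two] at h h'
  refine ⟨h, ?_⟩
  rw [h', show a + 2 = (a + 1) + 1 by ring, Real.Gamma_add_one (by positivity),
    Real.Gamma_add_one ha.ne']
  have := Real.Gamma_pos_of_pos ha
  field_simp
  ring

lemma gamma_m3 {a : ℝ} (ha : 0 < a) : Integrable (fun t : ℝ => t ^ 3) (gammaMeasure a (1 / 2)) ∧
    ∫ t, t ^ 3 ∂(gammaMeasure a (1 / 2)) = 8 * a * (a + 1) * (a + 2) := by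
  have h := gamma_rpow_integrable ha (s := 3) (by linarith)
  have h' := gamma_rpow_integral ha (s := 3) (by linarith)
  have e : ∀ t : ℝ, t ^ (3 : ℝ) = t ^ 3 := fun t => by
    rw [← Real.rpow_natCast]; norm_num
  simp only [e] at h h'
  refine ⟨h, ?_⟩
  rw [h', show a + 3 = (a + 1 + 1) + 1 by ring, Real.Gamma_add_one (by positivity),
    Real.Gamma_add_one (by positivity), Real.Gamma_add_one ha.ne']
  have := Real.Gamma_pos_of_pos ha
  field_simp
  ring

lemma gamma_minv {a : ℝ} (ha : 0 < a) (ha1 : 1 < a) : Integrable (fun t : ℝ => t⁻¹) (gammaMeasure a (1 / 2)) ∧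
    ∫ t, t⁻¹ ∂(gammaMeasure a (1 / 2)) = 1 / (2 * (a - 1)) := by
  have h := gamma_rpow_integrable ha (s := -1) (by linarith)
  have h' := gamma_rpow_integral ha (s := -1) (by linarith)
  simp only [Real.rpow_neg_one] at h h'
  refine ⟨h, ?_⟩
  have hG : Real.Gamma a = (a - 1) * Real.Gamma (a - 1) := by
    have := Real.Gamma_add_one (s := a - 1) (by linarith)
    rwa [sub_add_cancel] at this
  rw [h', hG, ← sub_eq_add_neg]
  have := Real.Gamma_pos_of_pos (s := a - 1) (by linarith)
  have : a - 1 ≠ 0 := by linarith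
  field_simp

lemma gamma_log_integrable {a : ℝ} (ha : 0 < a) (ha1 : 1 < a) :
    Integrable (fun t : ℝ => Real.log t) (gammaMeasure a (1 / 2)) := by
  refine Integrable.mono' ((gamma_m1 ha).1.add (gamma_minv ha ha1).1)
    Real.measurable_log.aestronglyMeasurable ?_
  filter_upwards [gamma_ae_pos ha] with t ht
  have h1 := Real.log_le_sub_one_of_pos ht
  have h2 := Real.log_le_sub_one_of_pos (inv_pos.2 ht)
  rw [Real.log_inv] at h2
  have : 0 < t⁻¹ := inv_pos.2 ht
  simp only [Real.norm_eq_abs, Pi.add_apply, abs_le]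
  constructor <;> linarith

lemma gamma_log_lower {a : ℝ} (ha : 0 < a) (ha1 : 1 < a) :
    Real.log (2 * a) - 1 / (a - 1) ≤ ∫ t, Real.log t ∂(gammaMeasure a (1 / 2)) := by
  have := isProbabilityMeasure_gammaMeasure ha (show (0 : ℝ) < 1 / 2 by norm_num)
  have hi := (gamma_minv ha ha1).1
  have h : ∫ t, (Real.log (2 * a) + 1 - 2 * a * t⁻¹) ∂(gammaMeasure a (1 / 2)) ≤
      ∫ t, Real.log t ∂(gammaMeasure a (1 / 2)) := by
    apply integral_mono_ae ((integrable_const _).sub (hi.const_mul _))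
      (gamma_log_integrable ha ha1)
    filter_upwards [gamma_ae_pos ha] with t ht
    have h2 := Real.log_le_sub_one_of_pos (x := 2 * a * t⁻¹) (by positivity)
    rw [Real.log_mul (by positivity) (by positivity), Real.log_inv] at h2
    simp only [Pi.sub_apply]
    linarith
  rw [integral_sub (integrable_const _) (hi.const_mul _), integral_const_mul,
    (gamma_minv ha ha1).2] at h
  simp only [integral_const, probReal_univ, smul_eq_mul, one_mul] at h
  have : a - 1 ≠ 0 := by linarith
  have e : 2 * a * (1 / (2 * (a - 1))) = 1 + 1 / (a - 1) := by field_simp; ring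
  rw [e] at h
  linarith

lemma gamma_log_upper {a : ℝ} (ha : 0 < a) (ha1 : 1 < a) :
    ∫ t, Real.log t ∂(gammaMeasure a (1 / 2)) ≤ Real.log (2 * a) - 1 / (2 * a) + 2 / (3 * a ^ 2) := by
  have := isProbabilityMeasure_gammaMeasure ha (show (0 : ℝ) < 1 / 2 by norm_num)
  obtain ⟨i1, e1⟩ := gamma_m1 ha
  obtain ⟨i2, e2⟩ := gamma_m2 ha
  obtain ⟨i3, e3⟩ := gamma_m3 ha
  set μ := gammaMeasure a (1 / 2)
  have hgint : Integrable (fun t : ℝ => (3 / (2 * a) * t + (- 3 / (8 * a ^ 2)) * t ^ 2)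
    + 1 / (24 * a ^ 3) * t ^ 3) μ := ((i1.const_mul _).add (i2.const_mul _)).add (i3.const_mul _)
  have h : ∫ t, Real.log t ∂μ ≤ ∫ t, ((3 / (2 * a) * t + (- 3 / (8 * a ^ 2)) * t ^ 2)
    + 1 / (24 * a ^ 3) * t ^ 3) + (Real.log (2 * a) - 11 / 6) ∂μ := by
    apply integral_mono_ae (gamma_log_integrable ha ha1) (hgint.add (integrable_const _))
    filter_upwards [gamma_ae_pos ha] with t ht
    have h2 := log_le_cubic (u := t / (2 * a)) (by positivity)
    rw [Real.log_div (by positivity) (by positivity)] at h2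
    have : (t / (2 * a) - 1) - (t / (2 * a) - 1) ^ 2 / 2 + (t / (2 * a) - 1) ^ 3 / 3 =
      ((3 / (2 * a) * t + (- 3 / (8 * a ^ 2)) * t ^ 2)
    + 1 / (24 * a ^ 3) * t ^ 3) - 11 / 6 := by field_simp; ring
    simp only [Pi.add_apply]
    linarith
  have hint12 : Integrable (fun t : ℝ => 3 / (2 * a) * t + (- 3 / (8 * a ^ 2)) * t ^ 2) μ :=
    (i1.const_mul _).add (i2.const_mul _)
  rw [integral_add hgint (integrable_const _), integral_add hint12
    (i3.const_mul _), integral_add (i1.const_mul _) (i2.const_mul _), integral_const_mul,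
    integral_const_mul, integral_const_mul, e1, e2, e3] at h
  refine h.trans (le_of_eq ?_)
  simp only [integral_const, probReal_univ, smul_eq_mul, one_mul]
  field_simp
  ring

lemma log_Gamma_lower {m : ℕ} (hm : 0 < m) :
    Real.log (2 * Real.pi) / 2 + ((m : ℝ) / 2 - 1 / 2) * Real.log (m / 2) - m / 2 ≤
      Real.log (Real.Gamma ((m : ℝ) / 2)) := by
  set s : ℝ := (m : ℝ) / 2 with hs
  have hm' : (0 : ℝ) < m := by exact_mod_cast hm
  have hs0 : 0 < s := by positivity
  have h1 := Real.Gamma_mul_Gamma_add_half_of_pos hs0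
  have hG := Real.Gamma_pos_of_pos hs0
  have hG2 := Real.Gamma_pos_of_pos (s := s + 1 / 2) (by positivity)
  have h2 : Real.log (Real.Gamma (s + 1 / 2)) ≤ Real.log (Real.Gamma s) + Real.log s / 2 := by
    have := Real.convexOn_log_Gamma.2 (show s ∈ Set.Ioi (0 : ℝ) from hs0)
      (show s + 1 ∈ Set.Ioi (0 : ℝ) from (show 0 < s + 1 by positivity))
      (show (0 : ℝ) ≤ 1 / 2 by norm_num) (show (0 : ℝ) ≤ 1 / 2 by norm_num) (by norm_num)
    simp only [smul_eq_mul, Function.comp] at this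
    rw [Real.Gamma_add_one hs0.ne', Real.log_mul hs0.ne' hG.ne',
      show 1 / 2 * s + 1 / 2 * (s + 1) = s + 1 / 2 by ring] at this
    linarith
  have h3 := congrArg Real.log h1
  have e2s : 2 * s = ((m - 1 : ℕ) : ℝ) + 1 := by
    rw [hs, Nat.cast_sub (by omega)]; push_cast; ring
  rw [Real.log_mul hG.ne' hG2.ne', e2s, Real.Gamma_nat_eq_factorial, ← e2s,
    Real.log_mul (by positivity) (by positivity), Real.log_mul (by positivity) (by positivity),
    Real.log_rpow two_pos, Real.log_sqrt Real.pi_pos.le] at h3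
  have h4 := Real.log_le_log (by positivity) (Stirling.le_factorial_stirling m)
  rw [Real.log_mul (by positivity) (by positivity), Real.log_sqrt (by positivity), Real.log_pow,
    Real.log_div (by positivity) (by positivity), Real.log_exp,
    Real.log_mul (by positivity) (by positivity)] at h4
  have h5 : Real.log (m.factorial : ℝ) = Real.log m + Real.log ((m - 1).factorial : ℝ) := by
    rw [← Nat.mul_factorial_pred hm.ne']
    push_cast
    rw [Real.log_mul (by positivity) (by positivity)]
  have h6 : Real.log m = Real.log s + Real.log 2 := by
    rw [hs, Real.log_div hm'.ne' two_ne_zero]; ring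
  have h7 : (m : ℝ) = 2 * s := by rw [hs]; ring
  rw [h5, h6] at h4
  rw [Real.log_mul two_ne_zero Real.pi_pos.ne'] at h4 ⊢
  rw [h7] at h4
  nlinarith


open scoped NNReal in
lemma KLle_chisq {m : ℕ} (hm : 3 ≤ m) {d : ℝ≥0} (hd : 0 < d) (b : ℝ) :
    KLle (gammaMeasure ((m : ℝ) / 2) (1 / 2)) (gaussianReal b (2 * d))
      (((m - b) ^ 2 + 2 * m - 2 * d) / (4 * d) + ((Real.log d - Real.log m) / 2 + 7 / (3 * m))) := by
  have hm3 : (3 : ℝ) ≤ m := by exact_mod_cast hm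
  have hd' : (0 : ℝ) < d := by exact_mod_cast hd
  set a : ℝ := (m : ℝ) / 2 with ha_def
  have ha1 : 1 < a := by rw [ha_def]; linarith
  have ha : 0 < a := by linarith
  have hma : (m : ℝ) = 2 * a := by rw [ha_def]; ring
  have hprob := isProbabilityMeasure_gammaMeasure ha (show (0 : ℝ) < 1 / 2 by norm_num)
  obtain ⟨i1, e1⟩ := gamma_m1 ha
  obtain ⟨i2, e2⟩ := gamma_m2 ha
  have iL := gamma_log_integrable ha ha1
  have eL := gamma_log_upper ha ha1
  have eG := log_Gamma_lower (m := m) (by omega)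
  rw [← ha_def] at eG
  set c : ℝ := - a * Real.log 2 - Real.log (Real.Gamma a) + Real.log (2 * Real.pi * (2 * d)) / 2
    + b ^ 2 / (4 * d) with hc
  set φ : ℝ → ℝ := fun t => (a - 1) * Real.log t + (1 / (4 * d) * t ^ 2 +
    (- (b / (2 * d)) - 1 / 2) * t) + c with hφ
  have hii : Integrable (fun t : ℝ => 1 / (4 * (d : ℝ)) * t ^ 2 + (- (b / (2 * d)) - 1 / 2) * t)
    (gammaMeasure a (1 / 2)) := (i2.const_mul _).add (i1.const_mul _)
  have hiii : Integrable (fun t : ℝ => (a - 1) * Real.log t + (1 / (4 * (d : ℝ)) * t ^ 2 +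
    (- (b / (2 * d)) - 1 / 2) * t))
    (gammaMeasure a (1 / 2)) := (iL.const_mul _).add hii
  have hφi : Integrable φ (gammaMeasure a (1 / 2)) := hiii.add (integrable_const _)
  have key : KLle (gammaMeasure a (1 / 2)) (gaussianReal b (2 * d)) (∫ t, φ t ∂(gammaMeasure a (1 / 2))) := by
    apply KLle.gibbs hφi
    intro h hh
    have hw : (2 * d : ℝ≥0) ≠ 0 := by positivity
    have hφm : Measurable φ := by rw [hφ]; fun_prop
    rw [gaussianReal_of_var_ne_zero b hw, gammaMeasure,
      lintegral_withDensity_eq_lintegral_mul _ (measurable_gammaPDF' _ _) (by fun_prop),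
      lintegral_withDensity_eq_lintegral_mul _ (measurable_gaussianPDF _ _) hh]
    apply lintegral_mono
    intro t
    simp only [Pi.mul_apply]
    rcases le_or_gt t 0 with ht | ht
    · have : gammaPDF a (1 / 2) t = 0 := by
        rcases ht.lt_or_eq with h0 | h0
        · exact gammaPDF_of_neg h0
        · rw [gammaPDF, gammaPDFReal, h0, Real.zero_rpow (by linarith)]
          simp
      rw [this]; simp
    have : gaussianPDF b (2 * d) t = gammaPDF a (1 / 2) t * ENNReal.ofReal (Real.exp (-φ t)) := by
      simp only [gaussianPDF, gammaPDF]
      rw [← ENNReal.ofReal_mul (gammaPDFReal_nonneg ha (by norm_num) _)]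
      congr 1
      simp only [gaussianPDFReal, hφ, gammaPDFReal, if_pos ht.le, hc, NNReal.coe_mul, NNReal.coe_ofNat]
      have e1 : √(2 * Real.pi * (2 * d)) = Real.exp (Real.log (2 * Real.pi * (2 * d)) / 2) := by
        rw [← Real.log_sqrt (by positivity), Real.exp_log (by positivity)]
      have e3 : (1 / 2 : ℝ) ^ a = Real.exp (- a * Real.log 2) := by
        rw [Real.rpow_def_of_pos (by norm_num), one_div, Real.log_inv]; congr 1; ring
      have e4 : t ^ (a - 1) = Real.exp ((a - 1) * Real.log t) := by
        rw [Real.rpow_def_of_pos ht]; congr 1; ring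
      have e5 : Real.Gamma a = Real.exp (Real.log (Real.Gamma a)) :=
        (Real.exp_log (Real.Gamma_pos_of_pos ha)).symm
      rw [e1, e3, e4]
      nth_rw 1 [e5]
      rw [← Real.exp_neg, ← Real.exp_sub, ← Real.exp_add, ← Real.exp_add, ← Real.exp_add,
        ← Real.exp_add]
      congr 1
      field_simp
      ring
    rw [this, mul_comm (h t), mul_assoc]
  refine key.mono ?_
  have hE : ∫ t, φ t ∂(gammaMeasure a (1 / 2)) = (a - 1) * ∫ t, Real.log t ∂(gammaMeasure a (1 / 2))
      + (1 / (4 * d) * (4 * a * (a + 1)) + (- (b / (2 * d)) - 1 / 2) * (2 * a)) + c := by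
    simp only [hφ]
    rw [integral_add hiii (integrable_const _), integral_add (iL.const_mul _) hii,
      integral_add (i2.const_mul _) (i1.const_mul _), integral_const_mul, integral_const_mul,
      integral_const_mul, e1, e2]
    simp only [integral_const, probReal_univ, smul_eq_mul, one_mul]
  rw [hE]
  have h1 := mul_le_mul_of_nonneg_left eL (show 0 ≤ a - 1 by linarith)
  have l1 : Real.log (2 * a) = Real.log 2 + Real.log a := Real.log_mul two_ne_zero ha.ne'
  have l2 : Real.log (2 * Real.pi * (2 * d)) = Real.log (2 * Real.pi) + (Real.log 2 + Real.log d) := by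
    rw [Real.log_mul (by positivity) (by positivity), Real.log_mul two_ne_zero hd'.ne']
  have e6 : (a - 1) * (- (1 / (2 * a)) + 2 / (3 * a ^ 2)) ≤ - 1 / 2 + 7 / (3 * m) := by
    have : - 1 / 2 + 7 / (3 * (m : ℝ)) - (a - 1) * (- (1 / (2 * a)) + 2 / (3 * a ^ 2))
      = 2 / (3 * a ^ 2) := by rw [hma]; field_simp; ring
    have h0 : 0 ≤ 2 / (3 * a ^ 2) := by positivity
    linarith
  have e7 : ((m - b) ^ 2 + 2 * m - 2 * d) / (4 * (d : ℝ)) = 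
     (1 / (4 * d) * (4 * a * (a + 1)) + (- (b / (2 * d)) - 1 / 2) * (2 * a)) + b ^ 2 / (4 * d)
      + a - 1 / 2 := by
    rw [hma]; field_simp; ring
  rw [e7, hc, l2]
  have l3 : Real.log m = Real.log 2 + Real.log a := by rw [hma, l1]
  have l4 : Real.log (↑m / 2) = Real.log a := rfl
  rw [l3]
  rw [l4] at eG
  rw [l1] at h1
  nlinarith


open scoped NNReal in
lemma KLle_diag {m : ℕ} (hm : 3 ≤ m) {d : ℕ} (hd : 0 < d) (A : ℝ) :
    KLle ((gam m).map (fun y => A + ∑ i, y i ^ 2)) (gaussianReal d (2 * (d : ℝ≥0)))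
      (((A + m - d) ^ 2 + 2 * m - 2 * d) / (4 * d) + ((Real.log d - Real.log m) / 2 + 7 / (3 * m))) := by
  have h := KLle_chisq hm (d := (d : ℝ≥0)) (by exact_mod_cast hd) ((d : ℝ) - A)
  have h2 := h.map (f := fun t : ℝ => A + t) (by fun_prop)
  rw [gaussianReal_map_const_add, ← map_sq_gam (by omega), Measure.map_map (by fun_prop) (by fun_prop),
    sub_add_cancel] at h2
  refine KLle.mono h2 (le_of_eq ?_)
  simp only [NNReal.coe_natCast]
  ring

open scoped NNReal in
lemma KLle_row {n : ℕ} {d : ℕ} (hd : 0 < d) (c : Fin n → ℝ) {r : ℝ} (hr : 0 < r) :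
    KLle ((gam n).map (fun z j => c j + Real.sqrt r * z j))
      (Measure.pi fun _ : Fin n => gaussianReal 0 (d : ℝ≥0))
      (∑ j, ((Real.log d - Real.log r) / 2 + (r + c j ^ 2) / (2 * d) - 1 / 2)) := by
  obtain ⟨v, hv⟩ : ∃ v : ℝ≥0, (v : ℝ) = r := ⟨⟨r, hr.le⟩, rfl⟩
  have hv0 : v ≠ 0 := by
    rintro rfl
    simp at hv; linarith
  have e : (gam n).map (fun z j => c j + Real.sqrt r * z j) =
      Measure.pi fun j => gaussianReal (c j) v := by
    have h1 : ∀ j, (gaussianReal 0 1).map (fun z => c j + Real.sqrt r * z) = gaussianReal (c j) v := by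
      intro j
      have : (fun z => c j + Real.sqrt r * z) = (fun t => c j + t) ∘ (fun z => Real.sqrt r * z) := rfl
      rw [this, ← Measure.map_map (by fun_prop) (by fun_prop), gaussianReal_map_const_mul,
        gaussianReal_map_const_add]
      congr 1
      · ring
      · ext; simp [hv, Real.sq_sqrt hr.le]
    have h2 := Measure.pi_map_pi (μ := fun _ : Fin n => gaussianReal 0 1)
      (f := fun j z => c j + Real.sqrt r * z) (fun j => by fun_prop)
    rw [h2]
    simp only [h1]
  rw [e]
  refine KLle.mono (KLle.pi (fun j => KLle_gaussian (c j) 0 hv0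
    (show (d : ℝ≥0) ≠ 0 by positivity))) (le_of_eq ?_)
  simp [hv]

lemma gam_log_facts {m : ℕ} (hm : 3 ≤ m) :
    (∀ᵐ y ∂(gam m), 0 < ∑ i, y i ^ 2) ∧
    Integrable (fun y : Fin m → ℝ => ∑ i, y i ^ 2) (gam m) ∧
    ∫ y : Fin m → ℝ, ∑ i, y i ^ 2 ∂(gam m) = m ∧
    Integrable (fun y : Fin m → ℝ => Real.log (∑ i, y i ^ 2)) (gam m) ∧
    Real.log m - 2 / (m - 2) ≤ ∫ y : Fin m → ℝ, Real.log (∑ i, y i ^ 2) ∂(gam m) := by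
  have hm3 : (3 : ℝ) ≤ m := by exact_mod_cast hm
  have ha1 : 1 < (m : ℝ) / 2 := by linarith
  have ha : 0 < (m : ℝ) / 2 := by linarith
  have hmeas : Measurable (fun y : Fin m → ℝ => ∑ i, y i ^ 2) := by fun_prop
  have hmap := map_sq_gam (m := m) (by omega)
  refine ⟨?_, ?_, ?_, ?_, ?_⟩
  · have := gamma_ae_pos ha
    rw [← hmap] at this
    exact ae_of_ae_map hmeas.aemeasurable this
  · have := (gamma_m1 ha).1
    rw [← hmap] at this
    exact (integrable_map_measure (by fun_prop) hmeas.aemeasurable).1 this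
  · have := (gamma_m1 ha).2
    rw [← hmap, integral_map hmeas.aemeasurable (by fun_prop)] at this
    rw [this]; ring
  · have := gamma_log_integrable ha ha1
    rw [← hmap] at this
    exact (integrable_map_measure Real.measurable_log.aestronglyMeasurable hmeas.aemeasurable).1 this
  · have := gamma_log_lower ha ha1
    rw [← hmap, integral_map hmeas.aemeasurable Real.measurable_log.aestronglyMeasurable] at this
    refine le_trans (le_of_eq ?_) this
    congr 1
    · congr 1; ring
    · have : (m : ℝ) - 2 ≠ 0 := by linarith
      have : (m : ℝ) / 2 - 1 ≠ 0 := by linarith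
      field_simp

lemma row_expect {m n d : ℕ} (hm : 3 ≤ m) (hd : 0 < d) (c : Fin n → ℝ) :
    Integrable (fun y : Fin m → ℝ => ∑ j, ((Real.log d - Real.log (∑ i, y i ^ 2)) / 2 +
      ((∑ i, y i ^ 2) + c j ^ 2) / (2 * d) - 1 / 2)) (gam m) ∧
    ∫ y : Fin m → ℝ, ∑ j, ((Real.log d - Real.log (∑ i, y i ^ 2)) / 2 +
      ((∑ i, y i ^ 2) + c j ^ 2) / (2 * d) - 1 / 2) ∂(gam m) ≤
      ∑ j, ((c j ^ 2 + m - d) / (2 * d) + ((Real.log d - Real.log m) / 2 + 1 / (m - 2))) := by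
  obtain ⟨-, i1, e1, iL, eL⟩ := gam_log_facts hm
  have hd' : (0 : ℝ) < d := by exact_mod_cast hd
  have hE : ∀ j : Fin n, (fun y : Fin m → ℝ => ((Real.log d - Real.log (∑ i, y i ^ 2)) / 2 +
      ((∑ i, y i ^ 2) + c j ^ 2) / (2 * d) - 1 / 2)) = fun y : Fin m → ℝ =>
      ((-1 / 2) * Real.log (∑ i, y i ^ 2) + 1 / (2 * d) * (∑ i, y i ^ 2))
        + (Real.log d / 2 + c j ^ 2 / (2 * d) - 1 / 2) := by
    intro j; ext y; field_simp; ring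
  have hi0 : Integrable (fun y : Fin m → ℝ => (-1 / 2) * Real.log (∑ i, y i ^ 2) +
      1 / (2 * (d : ℝ)) * (∑ i, y i ^ 2)) (gam m) := (iL.const_mul _).add (i1.const_mul _)
  have hi : ∀ j : Fin n, Integrable (fun y : Fin m → ℝ => ((Real.log d - Real.log (∑ i, y i ^ 2)) / 2 +
      ((∑ i, y i ^ 2) + c j ^ 2) / (2 * d) - 1 / 2)) (gam m) := by
    intro j
    rw [hE]
    exact hi0.add (integrable_const _)
  refine ⟨integrable_finsetSum _ (fun j _ => hi j), ?_⟩
  rw [integral_finsetSum _ (fun j _ => hi j)]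
  apply Finset.sum_le_sum
  intro j _
  rw [hE, integral_add hi0 (integrable_const _), integral_add (iL.const_mul _) (i1.const_mul _),
    integral_const_mul, integral_const_mul, e1]
  simp only [integral_const, probReal_univ, smul_eq_mul, one_mul]
  have : (c j ^ 2 + m - d) / (2 * (d : ℝ)) = 1 / (2 * d) * m + c j ^ 2 / (2 * d) - 1 / 2 := by
    field_simp; ring
  rw [this]
  have h2 : 2 / ((m : ℝ) - 2) = 2 * (1 / (m - 2)) := by ring
  linarith


lemma mp_cons {α : Type} [MeasurableSpace α] (μ : Measure α) [SigmaFinite μ] (n : ℕ) :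
    MeasurePreserving (fun p : α × (Fin n → α) => (Fin.cons p.1 p.2 : Fin (n + 1) → α))
      (μ.prod (Measure.pi fun _ => μ)) (Measure.pi fun _ => μ) := by
  have h := (measurePreserving_piFinSuccAbove (n := n) (α := fun _ => α) (fun _ => μ) 0).symm
  convert h using 1
  ext p i
  simp [Fin.insertNthEquiv]

lemma mp_swap_mid {α β γ δ : Type} [MeasurableSpace α] [MeasurableSpace β] [MeasurableSpace γ]
    [MeasurableSpace δ] (a : Measure α) (b : Measure β) (c : Measure γ) (e : Measure δ)
    [SigmaFinite a] [SigmaFinite b] [SigmaFinite c] [SigmaFinite e] :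
    MeasurePreserving (fun p : (α × β) × (γ × δ) => ((p.1.1, p.2.1), (p.1.2, p.2.2)))
      ((a.prod b).prod (c.prod e)) ((a.prod c).prod (b.prod e)) := by
  have h1 := measurePreserving_prodAssoc a b (c.prod e)
  have h2 := (MeasurePreserving.id a).prod (measurePreserving_prodAssoc b c e).symm
  have h3 := (MeasurePreserving.id a).prod
    ((Measure.measurePreserving_swap (μ := b) (ν := c)).prod (MeasurePreserving.id e))
  have h4 := (MeasurePreserving.id a).prod (measurePreserving_prodAssoc c b e)
  have h5 := (measurePreserving_prodAssoc a c (b.prod e)).symm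
  exact h5.comp (h4.comp (h3.comp (h2.comp h1)))

/-- assembling a symmetric matrix from its corner, first row and remaining block -/
def glue {n : ℕ} (p : (ℝ × (Fin n → ℝ)) × (Fin n → Fin n → ℝ)) : Fin (n + 1) → Fin (n + 1) → ℝ :=
  Fin.cons (Fin.cons p.1.1 p.1.2) (fun i => Fin.cons (p.1.2 i) (p.2 i))

@[simp] lemma glue_zero_zero {n : ℕ} (p : (ℝ × (Fin n → ℝ)) × (Fin n → Fin n → ℝ)) :
    glue p 0 0 = p.1.1 := rfl
@[simp] lemma glue_zero_succ {n : ℕ} (p : (ℝ × (Fin n → ℝ)) × (Fin n → Fin n → ℝ)) (j : Fin n) :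
    glue p 0 j.succ = p.1.2 j := rfl
@[simp] lemma glue_succ_zero {n : ℕ} (p : (ℝ × (Fin n → ℝ)) × (Fin n → Fin n → ℝ)) (i : Fin n) :
    glue p i.succ 0 = p.1.2 i := rfl
@[simp] lemma glue_succ_succ {n : ℕ} (p : (ℝ × (Fin n → ℝ)) × (Fin n → Fin n → ℝ)) (i j : Fin n) :
    glue p i.succ j.succ = p.2 i j := rfl

lemma measurable_glue {n : ℕ} : Measurable (glue (n := n)) := by
  rw [measurable_pi_iff]; intro i
  rw [measurable_pi_iff]; intro j
  refine Fin.cases ?_ (fun i => ?_) i <;> refine Fin.cases ?_ (fun j => ?_) j <;>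
  simp only [glue_zero_zero, glue_zero_succ, glue_succ_zero, glue_succ_succ] <;> fun_prop

noncomputable def upEquiv (n : ℕ) : Fin n ⊕ {q : Fin n × Fin n // q.1 < q.2} ≃
    {q : Fin (n + 1) × Fin (n + 1) // q.1 < q.2} :=
  Equiv.ofBijective (Sum.elim (fun j => ⟨(0, j.succ), Fin.succ_pos j⟩)
    (fun q => ⟨(q.1.1.succ, q.1.2.succ), Fin.succ_lt_succ_iff.2 q.2⟩)) (by
    constructor
    · rintro (j | ⟨⟨a, b⟩, h⟩) (j' | ⟨⟨a', b'⟩, h'⟩) H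
      · simpa using H
      · simp at H
        exact absurd H.1.symm (Fin.succ_ne_zero _)
      · simp at H
      · simpa using H
    · rintro ⟨⟨a, b⟩, h⟩
      rcases Fin.eq_zero_or_eq_succ a with rfl | ⟨a, rfl⟩
      · rcases Fin.eq_zero_or_eq_succ b with rfl | ⟨b, rfl⟩
        · simp at h
        · exact ⟨.inl b, rfl⟩
      · rcases Fin.eq_zero_or_eq_succ b with rfl | ⟨b, rfl⟩
        · simp at h
        · exact ⟨.inr ⟨(a, b), Fin.succ_lt_succ_iff.1 h⟩, rfl⟩)

noncomputable def joinMap (n : ℕ) (p : (Fin n → ℝ) × ({q : Fin n × Fin n // q.1 < q.2} → ℝ)) :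
    {q : Fin (n + 1) × Fin (n + 1) // q.1 < q.2} → ℝ :=
  fun q => Sum.elim p.1 p.2 ((upEquiv n).symm q)

lemma joinMap_zero (n : ℕ) (p) (j : Fin n) (h) : joinMap n p ⟨(0, j.succ), h⟩ = p.1 j := by
  have : (⟨(0, j.succ), h⟩ : {q : Fin (n + 1) × Fin (n + 1) // q.1 < q.2}) = upEquiv n (.inl j) := rfl
  rw [joinMap, this, Equiv.symm_apply_apply]; rfl

lemma joinMap_succ (n : ℕ) (p) (i j : Fin n) (h) (h') :
    joinMap n p ⟨(i.succ, j.succ), h⟩ = p.2 ⟨(i, j), h'⟩ := by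
  have : (⟨(i.succ, j.succ), h⟩ : {q : Fin (n + 1) × Fin (n + 1) // q.1 < q.2}) =
    upEquiv n (.inr ⟨(i, j), h'⟩) := rfl
  rw [joinMap, this, Equiv.symm_apply_apply]; rfl

lemma mp_join (n : ℕ) (μ : Measure ℝ) [SigmaFinite μ] :
    MeasurePreserving (joinMap n)
      ((Measure.pi fun _ : Fin n => μ).prod
        (Measure.pi fun _ : {q : Fin n × Fin n // q.1 < q.2} => μ))
      (Measure.pi fun _ : {q : Fin (n + 1) × Fin (n + 1) // q.1 < q.2} => μ) := by
  have h1 := measurePreserving_sumPiEquivProdPi_symm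
    (ι := Fin n) (ι' := {q : Fin n × Fin n // q.1 < q.2}) (X := fun _ => ℝ) (fun _ => μ)
  have h2 := measurePreserving_piCongrLeft
    (α := fun _ : {q : Fin (n + 1) × Fin (n + 1) // q.1 < q.2} => ℝ) (fun _ => μ) (upEquiv n)
  convert h2.comp h1 using 1
  ext p q
  obtain ⟨x, rfl⟩ := (upEquiv n).surjective q
  simp only [Function.comp, joinMap, Equiv.symm_apply_apply, MeasurableEquiv.piCongrLeft]
  rw [MeasurableEquiv.coe_mk, Equiv.piCongrLeft_apply_apply]
  rcases x with x | x <;> rfl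

open scoped NNReal in
lemma goe_succ (n d : ℕ) :
    shiftedGoeLaw (n + 1) d = (((gaussianReal d (2 * (d : ℝ≥0))).prod
      (Measure.pi fun _ : Fin n => gaussianReal 0 (d : ℝ≥0))).prod (shiftedGoeLaw n d)).map glue := by
  have hd1 : (gaussianReal 0 2).map (fun x => Real.sqrt d * x + d) = gaussianReal d (2 * (d : ℝ≥0)) := by
    have : (fun x : ℝ => Real.sqrt d * x + d) = (fun t => t + (d : ℝ)) ∘ (fun z => Real.sqrt d * z) := rfl
    rw [this, ← Measure.map_map (by fun_prop) (by fun_prop), gaussianReal_map_const_mul,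
        gaussianReal_map_add_const]
    congr 1
    · ring
    · ext; simp [mul_comm]
  have hd2 : (gaussianReal 0 1).map (fun x => Real.sqrt d * x) = gaussianReal 0 (d : ℝ≥0) := by
    rw [gaussianReal_map_const_mul]
    congr 1
    · ring
    · ext; simp
  have hd3 : (gam n).map (fun x j => Real.sqrt d * x j) =
      Measure.pi fun _ : Fin n => gaussianReal 0 (d : ℝ≥0) := by
    have h2 := Measure.pi_map_pi (μ := fun _ : Fin n => gaussianReal 0 1)
      (f := fun j z => Real.sqrt d * z) (fun j => by fun_prop)
    rw [h2]
    simp only [hd2]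
  rw [← hd1, ← hd3, Measure.map_prod_map _ _ (by fun_prop) (by fun_prop), shiftedGoeLaw]
  have hm : ∀ k : ℕ, Measurable (fun w : (Fin k → ℝ) × ({q : Fin k × Fin k // q.1 < q.2} → ℝ) =>
      fun i j => Real.sqrt d *
          (if i = j then w.1 i
            else if h : i < j then w.2 ⟨(i, j), h⟩
            else if h : j < i then w.2 ⟨(j, i), h⟩ else 0)
        + if i = j then (d : ℝ) else 0) := by
    intro k
    rw [measurable_pi_iff]; intro i
    rw [measurable_pi_iff]; intro j
    split_ifs <;> fun_prop
  have hsw := mp_swap_mid (gaussianReal 0 2) (Measure.pi fun _ : Fin n => gaussianReal 0 2) (gam n)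
    (Measure.pi fun _ : {q : Fin n × Fin n // q.1 < q.2} => gaussianReal 0 1)
  have hcj := ((mp_cons (gaussianReal 0 2) n)).prod (mp_join n (gaussianReal 0 1))
  rw [shiftedGoeLaw, Measure.map_prod_map _ _ (by fun_prop) (hm n), ← hsw.map_eq,
    Measure.map_map (Measurable.prodMap (by fun_prop) (hm n)) hsw.measurable,
    Measure.map_map measurable_glue
     ((Measurable.prodMap (by fun_prop) (hm n)).comp hsw.measurable),
    ← hcj.map_eq, Measure.map_map (hm _) hcj.measurable]
  congr 1
  ext ⟨⟨x, D⟩, c, U⟩ i j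
  refine Fin.cases ?_ (fun i => ?_) i <;> refine Fin.cases ?_ (fun j => ?_) j
  · simp
  · simp [joinMap_zero, (Fin.succ_ne_zero _).symm]
  · simp [joinMap_zero]
  · simp only [Function.comp, Prod.map, glue_succ_succ, Fin.succ_inj, Fin.cons_succ,
      Fin.succ_lt_succ_iff]
    congr 2
    split_ifs with h1 h2 h3
    · rfl
    · rw [joinMap_succ]
    · rw [joinMap_succ]
    · rfl


/-- Gaussian matrices -/
noncomputable abbrev gamM (n m : ℕ) : Measure (Fin n → Fin m → ℝ) :=
  Measure.pi fun _ : Fin n => gam m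

/-- law of `A + Y Yᵀ` -/
noncomputable def wl (n m : ℕ) (A : Fin n → Fin n → ℝ) : Measure (Fin n → Fin n → ℝ) :=
  (gamM n m).map (fun Y i j => A i j + ∑ k, Y i k * Y j k)

lemma exists_rot {m : ℕ} (y : Fin (m + 1) → ℝ) :
    ∃ T : (Fin (m + 1) → ℝ) → (Fin (m + 1) → ℝ), MeasurePreserving T (gam (m + 1)) (gam (m + 1)) ∧
      (∀ u v, ∑ k, T u k * T v k = ∑ k, u k * v k) ∧
      ∀ u, Real.sqrt (∑ k, y k ^ 2) * T u 0 = ∑ k, y k * u k := by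
  set yy : EuclideanSpace ℝ (Fin (m + 1)) := WithLp.toLp 2 y with hyy
  set w : EuclideanSpace ℝ (Fin (m + 1)) := ‖yy‖ • EuclideanSpace.single 0 1 with hw
  have hn : ‖yy‖ = ‖w‖ := by rw [hw, norm_smul]; simp
  have hR := Submodule.reflection_sub (F := EuclideanSpace ℝ (Fin (m + 1))) hn
  set R : EuclideanSpace ℝ (Fin (m + 1)) ≃ₗᵢ[ℝ] EuclideanSpace ℝ (Fin (m + 1)) := (ℝ ∙ (yy - w))ᗮ.reflection with hRdef
  have hin : ∀ u v : Fin (m + 1) → ℝ, inner ℝ (WithLp.toLp 2 u : EuclideanSpace ℝ (Fin (m + 1))) (WithLp.toLp 2 v) = ∑ k, u k * v k := by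
    intro u v
    simp [PiLp.inner_apply, mul_comm]
  refine ⟨fun u => WithLp.ofLp (R (WithLp.toLp 2 u)), ⟨?_, ?_⟩, ?_, ?_⟩
  · have : Continuous R := R.continuous
    apply Continuous.measurable
    exact (PiLp.continuous_ofLp 2 _).comp (this.comp (PiLp.continuous_toLp 2 _))
  · have h1 : (stdGaussian (EuclideanSpace ℝ (Fin (m + 1)))).map R = stdGaussian (EuclideanSpace ℝ (Fin (m + 1))) := stdGaussian_map R
    have h2 : (gam (m + 1)).map (WithLp.toLp 2) = stdGaussian (EuclideanSpace ℝ (Fin (m + 1))) := map_pi_eq_stdGaussian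
    have m1 : Measurable (WithLp.toLp 2 : (Fin (m + 1) → ℝ) → EuclideanSpace ℝ (Fin (m + 1))) := by fun_prop
    have m2 : Measurable (WithLp.ofLp : EuclideanSpace ℝ (Fin (m + 1)) → (Fin (m + 1) → ℝ)) := by fun_prop
    have m3 : Measurable R := R.continuous.measurable
    have h3 : (stdGaussian (EuclideanSpace ℝ (Fin (m + 1)))).map WithLp.ofLp = gam (m + 1) := by
      rw [← h2, Measure.map_map m2 m1]
      exact Measure.map_id
    have : (fun u : Fin (m + 1) → ℝ => WithLp.ofLp (R (WithLp.toLp 2 u))) =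
      WithLp.ofLp ∘ (R ∘ WithLp.toLp 2) := rfl
    rw [this, ← Measure.map_map m2 (m3.comp m1), ← Measure.map_map m3 m1, h2, h1, h3]
  · intro u v
    rw [← hin, ← hin]
    exact R.inner_map_map _ _
  · intro u
    have h1 : inner ℝ (R yy) (R (WithLp.toLp 2 u)) = inner ℝ yy (WithLp.toLp 2 u : EuclideanSpace ℝ (Fin (m + 1))) := R.inner_map_map _ _
    rw [hR, hw, inner_smul_left] at h1
    rw [← hin, ← hyy, ← h1]
    have : ‖yy‖ = Real.sqrt (∑ k, y k ^ 2) := by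
      rw [EuclideanSpace.norm_eq]; simp [hyy]
    rw [this]
    simp [EuclideanSpace.inner_single_left]

lemma map_fiber {α β γ : Type} [MeasurableSpace α] [MeasurableSpace β] [MeasurableSpace γ]
    (P : Measure α) (Q : Measure β) [SFinite P] [SFinite Q] {F G : α × β → γ}
    (hF : Measurable F) (hG : Measurable G)
    (h : ∀ y, Q.map (fun z => F (y, z)) = Q.map (fun z => G (y, z))) :
    (P.prod Q).map F = (P.prod Q).map G := by
  ext s hs
  rw [Measure.map_apply hF hs, Measure.map_apply hG hs, Measure.prod_apply (hF hs),
    Measure.prod_apply (hG hs)]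
  congr 1
  ext y
  have := DFunLike.congr_fun (h y) s
  have hFy : Measurable (fun z => F (y, z)) := hF.comp measurable_prodMk_left
  have hGy : Measurable (fun z => G (y, z)) := hG.comp measurable_prodMk_left
  rw [Measure.map_apply hFy hs, Measure.map_apply hGy hs] at this
  exact this

lemma mp_consM (n m : ℕ) :
    MeasurePreserving (fun (p : (Fin n → ℝ) × (Fin n → Fin m → ℝ)) (i : Fin n) =>
      (Fin.cons (p.1 i) (p.2 i) : Fin (m + 1) → ℝ)) ((gam n).prod (gamM n m)) (gamM n (m + 1)) := by
  have h1 := (measurePreserving_arrowProdEquivProdArrow ℝ (Fin m → ℝ) (Fin n)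
    (fun _ => gaussianReal 0 1) (fun _ => gam m)).symm
  have h2 := measurePreserving_pi (fun _ : Fin n => (gaussianReal 0 1).prod (gam m))
    (fun _ => gam (m + 1)) (fun _ => mp_cons (gaussianReal 0 1) m)
  exact h2.comp h1

/-- recursion map for Wishart -/
noncomputable def wrec {n m : ℕ} (A : Fin (n + 1) → Fin (n + 1) → ℝ)
    (p : ((Fin (m + 1) → ℝ) × (Fin n → ℝ)) × (Fin n → Fin m → ℝ)) :
    (ℝ × (Fin n → ℝ)) × (Fin n → Fin n → ℝ) :=
  ((A 0 0 + ∑ k, p.1.1 k ^ 2, fun j => A 0 j.succ + Real.sqrt (∑ k, p.1.1 k ^ 2) * p.1.2 j),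
    fun i j => (A i.succ j.succ + p.1.2 i * p.1.2 j) + ∑ k, p.2 i k * p.2 j k)

lemma wl_succ (n m : ℕ) (A : Fin (n + 1) → Fin (n + 1) → ℝ) (hA : ∀ i j, A i j = A j i) :
    wl (n + 1) (m + 1) A = ((((gam (m + 1)).prod (gam n)).prod (gamM n m)).map (wrec A)).map glue := by
  set F : (Fin (m + 1) → ℝ) × (Fin n → Fin (m + 1) → ℝ) → (Fin (n + 1) → Fin (n + 1) → ℝ) :=
    fun p => glue ((A 0 0 + ∑ k, p.1 k ^ 2, fun j => A 0 j.succ + ∑ k, p.1 k * p.2 j k),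
      fun i j => A i.succ j.succ + ∑ k, p.2 i k * p.2 j k) with hF
  set G : (Fin (m + 1) → ℝ) × (Fin n → Fin (m + 1) → ℝ) → (Fin (n + 1) → Fin (n + 1) → ℝ) :=
    fun p => glue ((A 0 0 + ∑ k, p.1 k ^ 2, fun j => A 0 j.succ + Real.sqrt (∑ k, p.1 k ^ 2) * p.2 j 0),
      fun i j => A i.succ j.succ + ∑ k, p.2 i k * p.2 j k) with hG
  have hFm : Measurable F := measurable_glue.comp (by fun_prop)
  have hGm : Measurable G := measurable_glue.comp (by fun_prop)
  have hWm : Measurable (wrec (m := m) A) := by unfold wrec; fun_prop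
  have s1 : wl (n + 1) (m + 1) A = ((gam (m + 1)).prod (gamM n (m + 1))).map F := by
    have hc := mp_cons (gam (m + 1)) n
    rw [wl, gamM, ← hc.map_eq, Measure.map_map (by fun_prop) hc.measurable]
    congr 1
    ext ⟨y, Y⟩ i j
    refine Fin.cases ?_ (fun i => ?_) i <;> refine Fin.cases ?_ (fun j => ?_) j <;>
      simp [hF, pow_two, mul_comm]
    exact hA _ _
  have s2 : ((gam (m + 1)).prod (gamM n (m + 1))).map F =
      ((gam (m + 1)).prod (gamM n (m + 1))).map G := by
    apply map_fiber _ _ hFm hGm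
    intro y
    obtain ⟨T, hT, hT1, hT2⟩ := exists_rot y
    have hTT := measurePreserving_pi (fun _ : Fin n => gam (m + 1)) (fun _ => gam (m + 1))
      (fun _ => hT)
    have : (fun z => F (y, z)) = (fun z => G (y, z)) ∘ (fun (Y : Fin n → Fin (m + 1) → ℝ) i => T (Y i)) := by
      ext Y
      simp only [hF, hG, Function.comp, hT1, hT2]
    have hGy : Measurable (fun z => G (y, z)) := hGm.comp measurable_prodMk_left
    rw [this, ← Measure.map_map hGy hTT.measurable, hTT.map_eq]
  have hassoc := measurePreserving_prodAssoc (gam (m + 1)) (gam n) (gamM n m)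
  have hcm := (MeasurePreserving.id (gam (m + 1))).prod (mp_consM n m)
  rw [s1, s2, ← hcm.map_eq, Measure.map_map hGm hcm.measurable, ← hassoc.map_eq,
    Measure.map_map (hGm.comp hcm.measurable) hassoc.measurable, Measure.map_map measurable_glue hWm]
  congr 1
  ext ⟨⟨y, z⟩, Y⟩ i j
  simp only [hG, Function.comp, wrec, Prod.map, MeasurableEquiv.prodAssoc, MeasurableEquiv.coe_mk,
    Equiv.prodAssoc_apply, id, Fin.sum_univ_succ (n := m), Fin.cons_zero, Fin.cons_succ, add_assoc]


lemma gauss_moments :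
    (Integrable (fun x : ℝ => x ^ 2) (gaussianReal 0 1) ∧ ∫ x, x ^ 2 ∂(gaussianReal 0 1) = 1) ∧
    (Integrable (fun x : ℝ => x ^ 4) (gaussianReal 0 1) ∧ ∫ x, x ^ 4 ∂(gaussianReal 0 1) = 3) := by
  have hmap := map_sq_gam (m := 1) (by norm_num)
  have he := measurePreserving_eval (fun _ : Fin 1 => gaussianReal 0 1) 0
  have e : (gaussianReal 0 1).map (fun x => x ^ 2) = gammaMeasure (1 / 2) (1 / 2) := by
    have h2 : (gaussianReal 0 1).map (fun x => x ^ 2) = gammaMeasure (((1 : ℕ) : ℝ) / 2) (1 / 2) := by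
      rw [← hmap, ← he.map_eq, Measure.map_map (by fun_prop) he.measurable]
      congr 1
      ext y
      simp
    rw [h2]; norm_num
  obtain ⟨i1, e1⟩ := gamma_m1 (show (0 : ℝ) < 1 / 2 by norm_num)
  obtain ⟨i2, e2⟩ := gamma_m2 (show (0 : ℝ) < 1 / 2 by norm_num)
  rw [← e] at i1 e1 i2 e2
  have hm : Measurable (fun x : ℝ => x ^ 2) := by fun_prop
  rw [integral_map hm.aemeasurable (by fun_prop)] at e1 e2
  have i1' := (integrable_map_measure (by fun_prop) hm.aemeasurable).1 i1
  have i2' := (integrable_map_measure (by fun_prop) hm.aemeasurable).1 i2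
  have h4 : (fun x : ℝ => x ^ 4) = fun x => (x ^ 2) ^ 2 := by ext; ring
  rw [h4]
  refine ⟨⟨i1', ?_⟩, i2', ?_⟩
  · rw [e1]; norm_num
  · rw [e2]; norm_num

lemma gam_moments (n : ℕ) (i j : Fin n) :
    (Integrable (fun z : Fin n → ℝ => z i * z j) (gam n) ∧
      ∫ z : Fin n → ℝ, z i * z j ∂(gam n) = if i = j then 1 else 0) ∧
    (Integrable (fun z : Fin n → ℝ => (z i * z j) ^ 2) (gam n) ∧
      ∫ z : Fin n → ℝ, (z i * z j) ^ 2 ∂(gam n) = if i = j then 3 else 1) := by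
  obtain ⟨⟨i2, e2⟩, ⟨i4, e4⟩⟩ := gauss_moments
  have i1 : Integrable (fun x : ℝ => x) (gaussianReal 0 1) :=
    (memLp_id_gaussianReal 2).integrable (by norm_num)
  have e1 : ∫ x, x ∂(gaussianReal 0 1) = 0 := integral_id_gaussianReal
  have I : ∀ {f : ℝ → ℝ} (k : Fin n), Integrable f (gaussianReal 0 1) →
      Integrable (fun z : Fin n → ℝ => f (z k)) (gam n) := fun {f} k hf =>
    integrable_comp_eval (μ := fun _ : Fin n => gaussianReal 0 1) (i := k) hf
  have E : ∀ {f : ℝ → ℝ} (k : Fin n), Integrable f (gaussianReal 0 1) →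
      ∫ z : Fin n → ℝ, f (z k) ∂(gam n) = ∫ x, f x ∂(gaussianReal 0 1) := fun {f} k hf =>
    integral_comp_eval (μ := fun _ : Fin n => gaussianReal 0 1) (i := k) hf.aestronglyMeasurable
  by_cases h : i = j
  · subst h
    have a1 : (fun z : Fin n → ℝ => z i * z i) = fun z => (z i) ^ 2 := by ext; ring
    have a2 : (fun z : Fin n → ℝ => (z i * z i) ^ 2) = fun z => (z i) ^ 4 := by ext; ring
    rw [a1, a2]
    simp only [if_true]
    exact ⟨⟨I i i2, (E i i2).trans e2⟩, I i i4, (E i i4).trans e4⟩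
  · have hind : iIndepFun (fun (k : Fin n) (z : Fin n → ℝ) => z k) (gam n) :=
      iIndepFun_pi (μ := fun _ : Fin n => gaussianReal 0 1) (X := fun _ x => x)
        (fun _ => aemeasurable_id)
    have hij := hind.indepFun h
    have hij2 : IndepFun (fun z : Fin n → ℝ => z i ^ 2) (fun z => z j ^ 2) (gam n) :=
      hij.comp (φ := fun x => x ^ 2) (ψ := fun x => x ^ 2) (by fun_prop) (by fun_prop)
    simp only [if_neg h, mul_pow]
    refine ⟨⟨hij.integrable_mul (I i i1) (I j i1), ?_⟩, hij2.integrable_mul (I i i2) (I j i2), ?_⟩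
    · rw [hij.integral_fun_mul_eq_mul_integral (I i i1).aestronglyMeasurable
        (I j i1).aestronglyMeasurable, E i i1, e1, zero_mul]
    · rw [hij2.integral_fun_mul_eq_mul_integral (I i i2).aestronglyMeasurable
        (I j i2).aestronglyMeasurable, E i i2, E j i2, e2, one_mul]

/-- the KL bound -/
noncomputable def klB (n : ℕ) (m d δ : ℝ) (A : Fin n → Fin n → ℝ) : ℝ :=
  (∑ i, ∑ j, (A i j ^ 2 + m - d) / (4 * d)) +
    (∑ i, (2 * A i i * (m - d) + (m - d) ^ 2 + (m - d)) / (4 * d)) + n ^ 2 * δ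

lemma klB_expect (n : ℕ) (m d δ : ℝ) (A : Fin n → Fin n → ℝ) :
    Integrable (fun z : Fin n → ℝ => klB n m d δ (fun i j => A i j + z i * z j)) (gam n) ∧
    ∫ z : Fin n → ℝ, klB n m d δ (fun i j => A i j + z i * z j) ∂(gam n) = klB n (m + 1) d δ A := by
  have h1 : ∀ i j, Integrable (fun z : Fin n → ℝ => ((A i j + z i * z j) ^ 2 + m - d) / (4 * d)) (gam n) ∧
    ∫ z : Fin n → ℝ, ((A i j + z i * z j) ^ 2 + m - d) / (4 * d) ∂(gam n) =
      (A i j ^ 2 + (m + 1) - d) / (4 * d) + if i = j then (2 * A i i + 2) / (4 * d) else 0 := by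
    intro i j
    obtain ⟨⟨i1, e1⟩, i2, e2⟩ := gam_moments n i j
    have he : (fun z : Fin n → ℝ => ((A i j + z i * z j) ^ 2 + m - d) / (4 * d)) = fun z =>
      ((1 / (4 * d)) * (z i * z j) ^ 2 + (2 * A i j / (4 * d)) * (z i * z j)) +
        (A i j ^ 2 + m - d) / (4 * d) := by ext z; ring
    have hi : Integrable (fun z : Fin n → ℝ =>
      ((1 / (4 * d)) * (z i * z j) ^ 2 + (2 * A i j / (4 * d)) * (z i * z j))) (gam n) :=
      (i2.const_mul _).add (i1.const_mul _)
    rw [he]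
    refine ⟨hi.add (integrable_const _), ?_⟩
    rw [integral_add hi (integrable_const _), integral_add (i2.const_mul _) (i1.const_mul _),
      integral_const_mul, integral_const_mul, e1, e2]
    simp only [integral_const, probReal_univ, smul_eq_mul, one_mul]
    split_ifs with h
    · subst h; ring
    · ring
  have h2 : ∀ i, Integrable (fun z : Fin n → ℝ =>
      (2 * (A i i + z i * z i) * (m - d) + (m - d) ^ 2 + (m - d)) / (4 * d)) (gam n) ∧
    ∫ z : Fin n → ℝ, (2 * (A i i + z i * z i) * (m - d) + (m - d) ^ 2 + (m - d)) / (4 * d) ∂(gam n) =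
      (2 * (A i i + 1) * (m - d) + (m - d) ^ 2 + (m - d)) / (4 * d) := by
    intro i
    obtain ⟨⟨i1, e1⟩, i2, e2⟩ := gam_moments n i i
    have he : (fun z : Fin n → ℝ => (2 * (A i i + z i * z i) * (m - d) + (m - d) ^ 2 + (m - d)) / (4 * d))
      = fun z => (2 * (m - d) / (4 * d)) * (z i * z i) +
        (2 * A i i * (m - d) + (m - d) ^ 2 + (m - d)) / (4 * d) := by ext z; ring
    rw [he]
    refine ⟨(i1.const_mul _).add (integrable_const _), ?_⟩
    rw [integral_add (i1.const_mul _) (integrable_const _), integral_const_mul, e1]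
    simp only [integral_const, probReal_univ, smul_eq_mul, one_mul, if_true]
    ring
  have j1 : Integrable (fun z : Fin n → ℝ => ∑ i, ∑ j, ((A i j + z i * z j) ^ 2 + m - d) / (4 * d)) (gam n) :=
    integrable_finsetSum _ (fun i _ => integrable_finsetSum _ (fun j _ => (h1 i j).1))
  have j2 : Integrable (fun z : Fin n → ℝ =>
      ∑ i, (2 * (A i i + z i * z i) * (m - d) + (m - d) ^ 2 + (m - d)) / (4 * d)) (gam n) :=
    integrable_finsetSum _ (fun i _ => (h2 i).1)
  have j12 : Integrable (fun z : Fin n → ℝ => (∑ i, ∑ j, ((A i j + z i * z j) ^ 2 + m - d) / (4 * d)) +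
    (∑ i, (2 * (A i i + z i * z i) * (m - d) + (m - d) ^ 2 + (m - d)) / (4 * d))) (gam n) := j1.add j2
  unfold klB
  refine ⟨j12.add (integrable_const _), ?_⟩
  rw [integral_add j12 (integrable_const _), integral_add j1 j2,
    integral_finsetSum _ (fun i _ => integrable_finsetSum _ (fun j _ => (h1 i j).1)),
    integral_finsetSum _ (fun i _ => (h2 i).1)]
  simp only [integral_const, probReal_univ, smul_eq_mul, one_mul]
  congr 1
  have : ∀ i, ∫ z : Fin n → ℝ, ∑ j, ((A i j + z i * z j) ^ 2 + m - d) / (4 * d) ∂(gam n) =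
      (∑ j, (A i j ^ 2 + (m + 1) - d) / (4 * d)) + (2 * A i i + 2) / (4 * d) := by
    intro i
    rw [integral_finsetSum _ (fun j _ => (h1 i j).1), Finset.sum_congr rfl (fun j _ => (h1 i j).2),
      Finset.sum_add_distrib]
    simp
  rw [Finset.sum_congr rfl (fun i _ => this i), Finset.sum_congr rfl (fun i _ => (h2 i).2),
    Finset.sum_add_distrib, add_assoc, ← Finset.sum_add_distrib]
  congr 1
  apply Finset.sum_congr rfl
  intro i _
  ring


instance wl_prob (n m : ℕ) (A : Fin n → Fin n → ℝ) : IsProbabilityMeasure (wl n m A) := by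
  unfold wl
  exact Measure.isProbabilityMeasure_map (by fun_prop)

instance goe_prob (n d : ℕ) : IsProbabilityMeasure (shiftedGoeLaw n d) := by
  unfold shiftedGoeLaw
  apply Measure.isProbabilityMeasure_map
  apply Measurable.aemeasurable
  rw [measurable_pi_iff]; intro i
  rw [measurable_pi_iff]; intro j
  split_ifs <;> fun_prop

lemma KLle_subsingleton {α : Type} [MeasurableSpace α] [Unique α] (μ ν : Measure α)
    [IsProbabilityMeasure μ] [IsProbabilityMeasure ν] : KLle μ ν 0 := by
  intro g _ _
  have : g = fun _ => g default := by ext x; rw [Unique.eq_default x]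
  rw [this]
  simp

lemma klB_succ (n : ℕ) (m d δ : ℝ) (hδ : 0 ≤ δ) (A : Fin (n + 1) → Fin (n + 1) → ℝ)
    (hd : 0 < d) (hA : ∀ i j, A i j = A j i) :
    (((A 0 0 + m - d) ^ 2 + 2 * m - 2 * d) / (4 * d) + δ) +
      (∑ j : Fin n, ((A 0 j.succ ^ 2 + m - d) / (2 * d) + δ)) +
      klB n m d δ (fun i j => A i.succ j.succ) ≤ klB (n + 1) m d δ A := by
  unfold klB
  simp only [Fin.sum_univ_succ (n := n), Finset.sum_add_distrib, Finset.sum_const, Finset.card_univ,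
    Fintype.card_fin, nsmul_eq_mul]
  have h : ∀ i : Fin n, A i.succ 0 = A 0 i.succ := fun i => hA _ _
  simp only [h]
  have h2 : ∑ j : Fin n, (A 0 j.succ ^ 2 + m - d) / (2 * d) =
      (∑ j : Fin n, (A 0 j.succ ^ 2 + m - d) / (4 * d)) + ∑ j : Fin n, (A 0 j.succ ^ 2 + m - d) / (4 * d) := by
    rw [← Finset.sum_add_distrib]
    apply Finset.sum_congr rfl
    intro j _
    field_simp; ring
  rw [h2]
  have h3 : ((A 0 0 + m - d) ^ 2 + 2 * m - 2 * d) / (4 * d) = (A 0 0 ^ 2 + m - d) / (4 * d) +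
    (2 * A 0 0 * (m - d) + (m - d) ^ 2 + (m - d)) / (4 * d) := by field_simp; ring
  rw [h3]
  push_cast
  have : 0 ≤ (n : ℝ) * δ := by positivity
  nlinarith

lemma main_kl {d : ℕ} (hd : 0 < d) {δ : ℝ} (hδ : 0 ≤ δ) : ∀ (n m : ℕ),
    (∀ k : ℕ, k ≤ m → m < k + n → 3 ≤ k ∧ (Real.log d - Real.log k) / 2 + 7 / (3 * k) ≤ δ ∧
      (Real.log d - Real.log k) / 2 + 1 / ((k : ℝ) - 2) ≤ δ) →
    ∀ A : Fin n → Fin n → ℝ, (∀ i j, A i j = A j i) →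
      KLle (wl n m A) (shiftedGoeLaw n d) (klB n m d δ A) := by
  have hd' : (0 : ℝ) < d := by exact_mod_cast hd
  intro n
  induction n with
  | zero =>
    intro m _ A _
    refine (KLle_subsingleton _ _).mono (le_of_eq ?_)
    simp [klB]
  | succ n ih =>
    intro m hk A hA
    obtain ⟨hm3, hk1, hk2⟩ := hk m le_rfl (by omega)
    obtain ⟨m, rfl⟩ : ∃ m', m = m' + 1 := ⟨m - 1, by omega⟩
    have hx := KLle_diag hm3 hd (A 0 0)
    obtain ⟨hpos, -⟩ := gam_log_facts hm3
    obtain ⟨hri, hre⟩ := row_expect hm3 hd (fun j : Fin n => A 0 j.succ)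
    have c1 := KLle.chain (P' := gam n) (by fun_prop)
      (Z := fun p : (Fin (m + 1) → ℝ) × (Fin n → ℝ) =>
        fun j => A 0 j.succ + Real.sqrt (∑ k, p.1 k ^ 2) * p.2 j) (by fun_prop) hx
      (hpos.mono (fun y hy => KLle_row hd (fun j : Fin n => A 0 j.succ) hy)) hri
    obtain ⟨hei, hee⟩ := klB_expect n m d δ (fun i j => A i.succ j.succ)
    have hih : ∀ p : (Fin (m + 1) → ℝ) × (Fin n → ℝ),
        KLle (wl n m (fun i j => A i.succ j.succ + p.2 i * p.2 j)) (shiftedGoeLaw n d)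
          (klB n m d δ (fun i j => A i.succ j.succ + p.2 i * p.2 j)) := fun p =>
      ih m (fun k h1 h2 => hk k (by omega) (by omega)) _
        (fun i j => by rw [hA i.succ j.succ]; ring)
    have c2 := KLle.chain (P' := gamM n m) (ν₂ := shiftedGoeLaw n d) (by fun_prop)
      (Z := fun p : ((Fin (m + 1) → ℝ) × (Fin n → ℝ)) × (Fin n → Fin m → ℝ) =>
        fun i j => (A i.succ j.succ + p.1.2 i * p.1.2 j) + ∑ k, p.2 i k * p.2 j k) (by fun_prop) c1
      (e := fun p => klB n m d δ (fun i j => A i.succ j.succ + p.2 i * p.2 j))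
      (ae_of_all _ hih) (hei.comp_snd _)
    have c3 := c2.map measurable_glue
    rw [← goe_succ] at c3
    rw [wl_succ n m A hA]
    refine KLle.mono c3 ?_
    rw [integral_fun_snd (fun z : Fin n → ℝ => klB n m d δ (fun i j => A i.succ j.succ + z i * z j)),
      hee, probReal_univ, one_smul]
    refine le_trans ?_ (klB_succ n ((m + 1 : ℕ) : ℝ) d δ hδ A hd' hA)
    have h4 : ∑ j : Fin n, ((A 0 j.succ ^ 2 + ((m + 1 : ℕ) : ℝ) - d) / (2 * d) +
        ((Real.log d - Real.log ((m + 1 : ℕ) : ℝ)) / 2 + 1 / (((m + 1 : ℕ) : ℝ) - 2))) ≤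
        ∑ j : Fin n, ((A 0 j.succ ^ 2 + ((m + 1 : ℕ) : ℝ) - d) / (2 * d) + δ) := by
      apply Finset.sum_le_sum
      intro j _
      linarith
    have h5 : ((m + 1 : ℕ) : ℝ) = (m : ℝ) + 1 := by push_cast; ring
    rw [← h5]
    linarith

lemma wishart_kl {n d : ℕ} (hn : 1 ≤ n) (hd : 2 * n + 6 ≤ d) :
    KLle (wishartLaw n d) (shiftedGoeLaw n d) (6 * (n : ℝ) ^ 3 / d) := by
  have hnr : (1 : ℝ) ≤ n := by exact_mod_cast hn
  have hdr : 2 * (n : ℝ) + 6 ≤ d := by exact_mod_cast hd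
  have hd0 : (0 : ℝ) < d := by linarith
  have hw : wishartLaw n d = wl n d (fun _ _ => 0) := by
    simp [wishartLaw, wl]
  rw [hw]
  have h := main_kl (d := d) (by omega) (δ := 6 * n / d) (by positivity) n d ?_ (fun _ _ => 0)
    (fun _ _ => rfl)
  · refine KLle.mono h (le_of_eq ?_)
    simp only [klB]
    simp
    ring
  · intro k hk1 hk2
    have hk : (d : ℝ) < k + n := by exact_mod_cast hk2
    have hk1r : (k : ℝ) ≤ d := by exact_mod_cast hk1
    have hk0 : (0 : ℝ) < k := by linarith
    have hlog : Real.log d - Real.log k ≤ 2 * (n / d) := by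
      rw [← Real.log_div hd0.ne' hk0.ne']
      refine (Real.log_le_sub_one_of_pos (by positivity)).trans ?_
      rw [div_sub_one hk0.ne', mul_div_assoc', div_le_div_iff₀ hk0 hd0]
      nlinarith
    have e1 : 6 * (n : ℝ) / d = n / d + 5 * n / d := by ring
    have h5 : 5 / (d : ℝ) ≤ 5 * n / d := by gcongr; linarith
    refine ⟨by omega, ?_, ?_⟩
    · have : 7 / (3 * (k : ℝ)) ≤ 5 / d := by
        rw [div_le_div_iff₀ (by positivity) hd0]; nlinarith
      linarith
    · have : 1 / ((k : ℝ) - 2) ≤ 5 / d := by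
        rw [div_le_div_iff₀ (by linarith) hd0]; nlinarith
      linarith

theorem tv_wishart_goe_tendsto_zero (d : ℕ → ℕ)
    (hdim : Tendsto (fun n => (d n : ℝ) / (n : ℝ) ^ 3) atTop atTop) :
    Tendsto (fun n => tvDist (wishartLaw n (d n)) (shiftedGoeLaw n (d n))) atTop (𝓝 0) := by
  have hlim : Tendsto (fun n => 2 * Real.sqrt (6 * ((d n : ℝ) / (n : ℝ) ^ 3)⁻¹)) atTop (𝓝 0) := by
    have h1 := (tendsto_inv_atTop_zero.comp hdim).const_mul 6
    have h2 := (Real.continuous_sqrt.tendsto _).comp h1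
    have h3 := h2.const_mul 2
    simpa using h3
  refine tendsto_of_tendsto_of_tendsto_of_le_of_le' tendsto_const_nhds hlim
    (Eventually.of_forall fun n => tvDist_nonneg _ _) ?_
  filter_upwards [hdim.eventually_ge_atTop 8, eventually_ge_atTop 1] with n h8 hn
  have hnr : (1 : ℝ) ≤ n := by exact_mod_cast hn
  have hn3 : (0 : ℝ) < (n : ℝ) ^ 3 := by positivity
  have hd8 : 8 * (n : ℝ) ^ 3 ≤ d n := by rwa [le_div_iff₀ hn3] at h8
  have hn1 : (n : ℝ) ≤ (n : ℝ) ^ 3 := le_self_pow₀ hnr (by norm_num)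
  have hd : 2 * n + 6 ≤ d n := by
    have : 2 * (n : ℝ) + 6 ≤ d n := by linarith
    exact_mod_cast this
  have hd0 : (0 : ℝ) < d n := by linarith
  have e : 6 * ((d n : ℝ) / (n : ℝ) ^ 3)⁻¹ = 6 * (n : ℝ) ^ 3 / d n := by
    rw [inv_div]; ring
  rw [e]
  have hpos : 0 < 6 * (n : ℝ) ^ 3 / d n := by positivity
  have : IsProbabilityMeasure (wishartLaw n (d n)) := by
    unfold wishartLaw
    exact Measure.isProbabilityMeasure_map (by fun_prop)
  apply KLle.tv (Real.sqrt_pos.2 hpos)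
  · refine Real.sqrt_le_iff.2 ⟨zero_le_one, ?_⟩
    rw [one_pow, div_le_one hd0]; linarith
  · rw [Real.sq_sqrt hpos.le]
    exact wishart_kl hn hd
end

section
/- There exists a universal constant C > 0 such that for all positive integers n < d, TV(W(n,d), W(n,d+1)) ≤ C·√( ((d+1)/(d−n))² − 1 ), where TV denotes the total variation distance between the laws of these random n×n matrices. -/
open MeasureTheory ProbabilityTheory Filter
open scoped BigOperators ENNReal Topology

open Matrix in
/-- symmetric matrices that pair nonnegatively with the PSD cone -/
def WX (n : ℕ) : Set (Fin n → Fin n → ℝ) :=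
  {W | (∀ i j, W i j = W j i) ∧
    ∀ S : Matrix (Fin n) (Fin n) ℝ, S.PosSemidef → 0 ≤ Matrix.trace (S * Matrix.of W)}

lemma continuous_tr (n : ℕ) (S : Matrix (Fin n) (Fin n) ℝ) :
    Continuous fun W : Fin n → Fin n → ℝ => Matrix.trace (S * Matrix.of W) := by
  simp only [Matrix.trace, Matrix.diag, Matrix.mul_apply, Matrix.of_apply]
  fun_prop

lemma isClosed_WX (n : ℕ) : IsClosed (WX n) := by
  unfold WX
  rw [Set.ofPred_and]
  refine IsClosed.inter ?_ ?_
  · simp only [Set.ofPred_forall]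
    exact isClosed_iInter fun i => isClosed_iInter fun j =>
      isClosed_eq (by fun_prop) (by fun_prop)
  · simp only [Set.ofPred_forall]
    exact isClosed_iInter fun S => isClosed_iInter fun _ =>
      isClosed_le continuous_const (continuous_tr n S)

noncomputable def lapFun (n : ℕ) (S : Matrix (Fin n) (Fin n) ℝ) (hS : S.PosSemidef) :
    BoundedContinuousFunction (WX n) ℝ :=
  BoundedContinuousFunction.ofNormedAddCommGroup
    (fun W => Real.exp (-(Matrix.trace (S * Matrix.of W.1)) / 2))
    (by
      have := (continuous_tr n S).comp (continuous_subtype_val (p := (· ∈ WX n)))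
      simp only [Function.comp_def] at this
      fun_prop)
    1
    (by
      intro W
      rw [Real.norm_eq_abs, Real.abs_exp, Real.exp_le_one_iff]
      have := W.2.2 S hS
      linarith)

lemma sep_sym {n : ℕ} {W V : Fin n → Fin n → ℝ} (hW : ∀ i j, W i j = W j i)
    (hV : ∀ i j, V i j = V j i)
    (h : ∀ S : Matrix (Fin n) (Fin n) ℝ, S.PosSemidef →
      Matrix.trace (S * Matrix.of W) = Matrix.trace (S * Matrix.of V)) : W = V := by
  have key : ∀ x : Fin n → ℝ, ∑ i, ∑ j, x i * x j * W j i = ∑ i, ∑ j, x i * x j * V j i := by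
    intro x
    have := h (Matrix.vecMulVec x x) (by
      have := Matrix.posSemidef_vecMulVec_self_star (R := ℝ) x
      simpa using this)
    simpa [Matrix.trace, Matrix.mul_apply, Matrix.vecMulVec_apply] using this
  have diag : ∀ i, W i i = V i i := by
    intro i
    have := key (Pi.single i 1)
    simpa [Pi.single_apply] using this
  ext i j
  have := key (Pi.single i 1 + Pi.single j 1)
  simp [Pi.single_apply, add_mul, mul_add, Finset.sum_add_distrib] at this
  have h1 := hW i j
  have h2 := hV i j
  have h3 := diag i
  have h4 := diag j
  linarith

lemma ext_laplace {n : ℕ} {μ ν : Measure (WX n)} [IsFiniteMeasure μ] [IsFiniteMeasure ν]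
    (h : ∀ S : Matrix (Fin n) (Fin n) ℝ, S.PosSemidef →
      ∫ W, Real.exp (-(Matrix.trace (S * Matrix.of W.1)) / 2) ∂μ =
      ∫ W, Real.exp (-(Matrix.trace (S * Matrix.of W.1)) / 2) ∂ν) : μ = ν := by
  haveI : CompleteSpace (WX n) := (isClosed_WX n).completeSpace_coe
  let M : Submonoid (BoundedContinuousFunction (WX n) ℝ) :=
    { carrier := {f | ∃ S hS, f = lapFun n S hS}
      mul_mem' := by
        rintro _ _ ⟨S, hS, rfl⟩ ⟨T, hT, rfl⟩
        refine ⟨S + T, hS.add hT, ?_⟩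
        ext W
        simp only [lapFun, BoundedContinuousFunction.coe_mul, Pi.mul_apply,
          BoundedContinuousFunction.coe_ofNormedAddCommGroup, ← Real.exp_add, add_mul,
          Matrix.trace_add]
        congr 1
        ring
      one_mem' := by
        refine ⟨0, Matrix.PosSemidef.zero, ?_⟩
        ext W
        simp [lapFun] }
  let A : StarSubalgebra ℝ (BoundedContinuousFunction (WX n) ℝ) :=
    { Algebra.adjoin ℝ (M : Set (BoundedContinuousFunction (WX n) ℝ)) with
      star_mem' := by
        intro a ha
        have : star a = a := by ext; simp
        rw [this]; exact ha }
  refine ext_of_forall_mem_subalgebra_integral_eq_of_pseudoEMetric_complete_countable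
    (𝕜 := ℝ) (A := A) ?_ ?_
  · intro W V hne
    by_contra hcon
    apply hne
    apply Subtype.ext
    refine sep_sym W.2.1 V.2.1 ?_
    intro S hS
    by_contra hne'
    apply hcon
    refine ⟨fun W => lapFun n S hS W, ?_, ?_⟩
    · refine ⟨BoundedContinuousFunction.toContinuousMapStarₐ ℝ (lapFun n S hS), ?_, rfl⟩
      refine ⟨lapFun n S hS, ?_, rfl⟩
      exact Algebra.subset_adjoin ⟨S, hS, rfl⟩
    · simp only [lapFun, BoundedContinuousFunction.coe_ofNormedAddCommGroup]
      intro he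
      apply hne'
      have := Real.exp_injective he
      linarith
  · intro g hg
    have hg' : g ∈ Submodule.span ℝ (M : Set (BoundedContinuousFunction (WX n) ℝ)) := by
      have h1 : g ∈ Subalgebra.toSubmodule
        (Algebra.adjoin ℝ (M : Set (BoundedContinuousFunction (WX n) ℝ))) := hg
      rwa [Algebra.adjoin_eq_span, Submonoid.closure_eq] at h1
    induction hg' using Submodule.span_induction with
    | mem x hx =>
      obtain ⟨S, hS, rfl⟩ := hx
      exact h S hS
    | zero => simp
    | add x y hx hy h1 h2 =>
      simp only [BoundedContinuousFunction.coe_add, Pi.add_apply]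
      rw [integral_add (x.integrable μ) (y.integrable μ),
        integral_add (x.integrable ν) (y.integrable ν),
        h1 (by rw [← Submonoid.closure_eq M, ← Algebra.adjoin_eq_span] at hx; exact hx),
        h2 (by rw [← Submonoid.closure_eq M, ← Algebra.adjoin_eq_span] at hy; exact hy)]
    | smul a x hx h1 =>
      simp only [BoundedContinuousFunction.coe_smul, smul_eq_mul]
      rw [integral_const_mul, integral_const_mul,
        h1 (by rw [← Submonoid.closure_eq M, ← Algebra.adjoin_eq_span] at hx; exact hx)]
lemma pi_withDensity' {ι : Type*} [Fintype ι] {E : Type*} [MeasurableSpace E]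
    (μ : Measure E) [SigmaFinite μ] (f : E → ℝ) (hf0 : ∀ x, 0 ≤ f x) (hf : Integrable f μ)
    (hfm : Measurable f) :
    Measure.pi (fun _ : ι => μ.withDensity fun x => ENNReal.ofReal (f x)) =
      (Measure.pi fun _ : ι => μ).withDensity fun x => ENNReal.ofReal (∏ i, f (x i)) := by
  haveI : IsFiniteMeasure (μ.withDensity fun x => ENNReal.ofReal (f x)) :=
    isFiniteMeasure_withDensity_ofReal hf.2
  refine Measure.pi_eq fun s hs => ?_
  rw [withDensity_apply _ (MeasurableSet.univ_pi hs), Measure.restrict_pi_pi,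
    ← ofReal_integral_eq_lintegral_ofReal, integral_fintype_prod_eq_prod,
    ENNReal.ofReal_prod_of_nonneg]
  · refine Finset.prod_congr rfl fun i _ => ?_
    rw [withDensity_apply _ (hs i), ofReal_integral_eq_lintegral_ofReal hf.integrableOn
      (ae_of_all _ hf0)]
  · exact fun i _ => integral_nonneg hf0
  · exact Integrable.fintype_prod_dep (f := fun _ => f) fun i => hf.integrableOn
  · exact ae_of_all _ fun x => Finset.prod_nonneg fun i _ => hf0 _

/-- the Gaussian measure on matrices -/
noncomputable abbrev GM (n d : ℕ) : Measure (Fin n → Fin d → ℝ) :=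
  Measure.pi fun _ : Fin n => Measure.pi fun _ : Fin d => gaussianReal 0 1

noncomputable def dens {n d : ℕ} (Y : Fin n → Fin d → ℝ) : ℝ :=
  ∏ i, ∏ k, gaussianPDFReal 0 1 (Y i k)

lemma GM_eq (n d : ℕ) : GM n d = volume.withDensity fun Y => ENNReal.ofReal (dens Y) := by
  have h1 : gaussianReal 0 1 = volume.withDensity fun x => ENNReal.ofReal (gaussianPDFReal 0 1 x) := by
    rw [gaussianReal_of_var_ne_zero _ one_ne_zero]; rfl
  have h2 := pi_withDensity' (ι := Fin d) (volume : Measure ℝ) (gaussianPDFReal 0 1)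
    (gaussianPDFReal_nonneg 0 1) (integrable_gaussianPDFReal 0 1) (measurable_gaussianPDFReal 0 1)
  rw [← h1] at h2
  have h3 := pi_withDensity' (ι := Fin n) (Measure.pi fun _ : Fin d => (volume : Measure ℝ))
    (fun x => ∏ k, gaussianPDFReal 0 1 (x k))
    (fun x => Finset.prod_nonneg fun k _ => gaussianPDFReal_nonneg 0 1 _)
    (Integrable.fintype_prod_dep (f := fun _ => gaussianPDFReal 0 1)
      fun i => integrable_gaussianPDFReal 0 1)
    (by
      have := measurable_gaussianPDFReal 0 1
      fun_prop)
  rw [← h2] at h3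
  exact h3

lemma dens_eq {n d : ℕ} (Y : Fin n → Fin d → ℝ) :
    dens Y = ((Real.sqrt (2 * Real.pi))⁻¹ ^ d) ^ n *
      Real.exp (-(Matrix.trace (Matrix.of Y * (Matrix.of Y).transpose)) / 2) := by
  have h : ∀ i k, gaussianPDFReal 0 1 (Y i k) =
      (Real.sqrt (2 * Real.pi))⁻¹ * Real.exp (-(Y i k * Y i k) / 2) := by
    intro i k
    simp [gaussianPDFReal, sq]
  simp only [dens, h, Finset.prod_mul_distrib, Finset.prod_const, Finset.card_univ,
    Fintype.card_fin, ← Real.exp_sum]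
  congr 2
  simp only [Matrix.trace, Matrix.diag, Matrix.mul_apply, Matrix.transpose_apply, Matrix.of_apply,
    neg_div, Finset.sum_neg_distrib, Finset.sum_div]

noncomputable def leftMul {n : ℕ} (d : ℕ) (A : Matrix (Fin n) (Fin n) ℝ) :
    (Fin n → Fin d → ℝ) →ₗ[ℝ] (Fin n → Fin d → ℝ) where
  toFun Y := A * Matrix.of Y
  map_add' X Y := Matrix.mul_add A (Matrix.of X) (Matrix.of Y)
  map_smul' c X := Matrix.mul_smul A c (Matrix.of X)

lemma det_leftMul {n : ℕ} (d : ℕ) (A : Matrix (Fin n) (Fin n) ℝ) :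
    LinearMap.det (leftMul d A) = A.det ^ d := by
  let e : (Fin d → Fin n → ℝ) ≃ₗ[ℝ] (Fin n → Fin d → ℝ) :=
    { toFun := fun Y i k => Y k i
      invFun := fun Y k i => Y i k
      map_add' := fun _ _ => rfl
      map_smul' := fun _ _ => rfl
      left_inv := fun _ => rfl
      right_inv := fun _ => rfl }
  have h : leftMul d A =
    e.toLinearMap ∘ₗ
      (LinearMap.pi fun i : Fin d => (Matrix.toLin' A) ∘ₗ LinearMap.proj i) ∘ₗ
      e.symm.toLinearMap := by
    refine LinearMap.ext fun Y => ?_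
    rfl
  rw [h, LinearMap.det_conj, LinearMap.det_pi]
  simp

lemma change_var {n d : ℕ} (A : Matrix (Fin n) (Fin n) ℝ) (hA : A.det ≠ 0)
    (F : (Fin n → Fin d → ℝ) → ℝ≥0∞) (hF : Measurable F) :
    ∫⁻ Y, F (leftMul d A Y) = ENNReal.ofReal |(A.det ^ d)⁻¹| * ∫⁻ Y, F Y := by
  have hdet : LinearMap.det (leftMul d A) ≠ 0 := by rw [det_leftMul]; exact pow_ne_zero _ hA
  have := Measure.map_linearMap_addHaar_eq_smul_addHaar
    (volume : Measure (Fin n → Fin d → ℝ)) hdet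
  have hm : Measurable (leftMul d A) := (LinearMap.continuous_of_finiteDimensional _).measurable
  rw [← lintegral_map hF hm, this, lintegral_smul_measure, det_leftMul, smul_eq_mul]

lemma dens_leftMul {n d : ℕ} (A S : Matrix (Fin n) (Fin n) ℝ) (hS : A.transpose * A = 1 + S)
    (Y : Fin n → Fin d → ℝ) :
    dens (leftMul d A Y) = dens Y *
      Real.exp (-(Matrix.trace (S * (Matrix.of Y * (Matrix.of Y).transpose))) / 2) := by
  rw [dens_eq, dens_eq, mul_assoc, ← Real.exp_add]
  congr 2
  have : Matrix.trace (Matrix.of (leftMul d A Y) * (Matrix.of (leftMul d A Y)).transpose) =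
      Matrix.trace ((A.transpose * A) * (Matrix.of Y * (Matrix.of Y).transpose)) := by
    change Matrix.trace ((A * Matrix.of Y) * (A * Matrix.of Y).transpose) = _
    rw [Matrix.transpose_mul, Matrix.mul_assoc, Matrix.trace_mul_comm A, Matrix.mul_assoc,
      Matrix.mul_assoc, ← Matrix.mul_assoc, Matrix.trace_mul_comm]
  rw [this, hS, add_mul, one_mul, Matrix.trace_add]
  ring

/-- the key Gaussian change of variables -/
lemma key_lap {n d : ℕ} (A S : Matrix (Fin n) (Fin n) ℝ) (hS : A.transpose * A = 1 + S)
    (hA : A.det ≠ 0) (h : (Fin n → Fin d → ℝ) → ℝ≥0∞) (hh : Measurable h) :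
    ∫⁻ Y, h (leftMul d A Y) * ENNReal.ofReal (Real.exp
      (-(Matrix.trace (S * (Matrix.of Y * (Matrix.of Y).transpose))) / 2)) ∂(GM n d)
    = ENNReal.ofReal |(A.det ^ d)⁻¹| * ∫⁻ Y, h Y ∂(GM n d) := by
  have hd : Measurable fun Y : Fin n → Fin d → ℝ => ENNReal.ofReal (dens Y) := by
    have := measurable_gaussianPDFReal 0 1
    unfold dens
    fun_prop
  have hm : Measurable (leftMul d A) := (LinearMap.continuous_of_finiteDimensional _).measurable
  have hd0 : ∀ Y : Fin n → Fin d → ℝ, 0 ≤ dens Y := fun Y =>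
    Finset.prod_nonneg fun i _ => Finset.prod_nonneg fun k _ => gaussianPDFReal_nonneg 0 1 _
  rw [GM_eq, lintegral_withDensity_eq_lintegral_mul _ hd hh,
    lintegral_withDensity_eq_lintegral_mul _ hd, ← change_var A hA _ (hd.mul hh)]
  · refine lintegral_congr fun Y => ?_
    simp only [Pi.mul_apply]
    rw [dens_leftMul A S hS, ENNReal.ofReal_mul (hd0 Y)]
    ring
  · refine (hh.comp hm).mul ?_
    simp only [Matrix.trace, Matrix.diag, Matrix.mul_apply, Matrix.of_apply, Matrix.transpose_apply]
    fun_prop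
/-- the Gram matrix -/
noncomputable def gram {n d : ℕ} (Y : Fin n → Fin d → ℝ) : Matrix (Fin n) (Fin n) ℝ :=
  Matrix.of Y * (Matrix.of Y).transpose

lemma gram_psd {n d : ℕ} (Y : Fin n → Fin d → ℝ) : (gram Y).PosSemidef := by
  have := Matrix.posSemidef_self_mul_conjTranspose (Matrix.of Y)
  simpa [gram, Matrix.conjTranspose_eq_transpose_of_trivial] using this

lemma gram_apply {n d : ℕ} (Y : Fin n → Fin d → ℝ) (i j : Fin n) :
    gram Y i j = ∑ k, Y i k * Y j k := by
  simp [gram, Matrix.mul_apply]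

lemma gram_mem {n d : ℕ} (Y : Fin n → Fin d → ℝ) :
    (fun i j => ∑ k, Y i k * Y j k) ∈ WX n := by
  refine ⟨fun i j => Finset.sum_congr rfl fun k _ => mul_comm _ _, fun S hS => ?_⟩
  have h : Matrix.of (fun i j => ∑ k, Y i k * Y j k) = gram Y := by
    ext i j; simp [gram_apply]
  rw [h, gram, ← Matrix.mul_assoc, Matrix.trace_mul_comm, ← Matrix.mul_assoc]
  have := hS.conjTranspose_mul_mul_same (Matrix.of Y)
  rw [Matrix.conjTranspose_eq_transpose_of_trivial] at this
  exact this.trace_nonneg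

noncomputable def phi {n d : ℕ} (Y : Fin n → Fin d → ℝ) : WX n :=
  ⟨fun i j => ∑ k, Y i k * Y j k, gram_mem Y⟩

lemma phi_gram {n d : ℕ} (Y : Fin n → Fin d → ℝ) : Matrix.of (phi Y).1 = gram Y := by
  ext i j; simp [gram_apply, phi]

lemma measurable_phi {n d : ℕ} : Measurable (phi : (Fin n → Fin d → ℝ) → WX n) := by
  refine Measurable.subtype_mk ?_
  fun_prop

lemma wishart_eq (n d : ℕ) :
    wishartLaw n d = ((GM n d).map phi).map Subtype.val := by
  rw [Measure.map_map measurable_subtype_coe measurable_phi]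
  rfl

/-- square root of determinant -/
noncomputable def sd {n : ℕ} (W : WX n) : ℝ := Real.sqrt (Matrix.det (Matrix.of W.1))

lemma sd_nonneg {n : ℕ} (W : WX n) : 0 ≤ sd W := Real.sqrt_nonneg _

lemma measurable_sd {n : ℕ} : Measurable (sd : WX n → ℝ) := by
  refine Measurable.sqrt ?_
  have : Continuous fun W : WX n => Matrix.det (Matrix.of W.1) := by
    refine Continuous.matrix_det ?_
    exact continuous_subtype_val
  exact this.measurable

lemma sd_sq {n d : ℕ} (Y : Fin n → Fin d → ℝ) : sd (phi Y) * sd (phi Y) = (gram Y).det := by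
  rw [sd, phi_gram, Real.mul_self_sqrt (gram_psd Y).det_nonneg]

lemma sd_leftMul {n d : ℕ} (A : Matrix (Fin n) (Fin n) ℝ) (Y : Fin n → Fin d → ℝ) :
    sd (phi (leftMul d A Y)) = |A.det| * sd (phi Y) := by
  rw [sd, sd, phi_gram, phi_gram]
  have : gram (leftMul d A Y) = A * gram Y * A.transpose := by
    change (A * Matrix.of Y) * (A * Matrix.of Y).transpose = _
    rw [Matrix.transpose_mul, gram]
    simp only [Matrix.mul_assoc]
  rw [this, Matrix.det_mul, Matrix.det_mul, Matrix.det_transpose,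
    show A.det * (gram Y).det * A.det = A.det ^ 2 * (gram Y).det by ring,
    Real.sqrt_mul (sq_nonneg _), Real.sqrt_sq_eq_abs]

open scoped MatrixOrder in
lemma exists_root {n : ℕ} (S : Matrix (Fin n) (Fin n) ℝ) (hS : S.PosSemidef) :
    ∃ A : Matrix (Fin n) (Fin n) ℝ, A.transpose * A = 1 + S ∧ A.det ≠ 0 := by
  have hpd : (1 + S).PosDef := Matrix.PosDef.one.add_posSemidef hS
  obtain ⟨A, hA⟩ := CStarAlgebra.nonneg_iff_eq_star_mul_self.mp hpd.posSemidef.nonneg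
  rw [Matrix.star_eq_conjTranspose, Matrix.conjTranspose_eq_transpose_of_trivial] at hA
  refine ⟨A, hA.symm, fun h0 => ?_⟩
  have := hpd.det_pos
  rw [hA, Matrix.det_mul, h0] at this
  simp at this

lemma tilt {n d : ℕ} (hfin : ∫⁻ Y, ENNReal.ofReal (sd (phi Y)) ∂(GM n d) ≠ ∞) :
    ((GM n d).withDensity fun Y => ENNReal.ofReal (sd (phi Y))).map phi =
      (∫⁻ Y, ENNReal.ofReal (sd (phi Y)) ∂(GM n d)) • (GM n (d + 1)).map phi := by
  have hsm : Measurable fun Y : Fin n → Fin d → ℝ => ENNReal.ofReal (sd (phi Y)) :=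
    (measurable_sd.comp measurable_phi).ennreal_ofReal
  have : IsFiniteMeasure ((GM n d).withDensity fun Y => ENNReal.ofReal (sd (phi Y))) :=
    isFiniteMeasure_withDensity hfin
  have : IsProbabilityMeasure ((GM n (d + 1)).map (phi : _ → WX n)) :=
    Measure.isProbabilityMeasure_map measurable_phi.aemeasurable
  have : IsFiniteMeasure ((∫⁻ Y, ENNReal.ofReal (sd (phi Y)) ∂(GM n d)) •
      (GM n (d + 1)).map (phi : _ → WX n)) := Measure.smul_finite _ hfin
  refine ext_laplace fun S hS => ?_
  have hc : Continuous fun W : WX n => Real.exp (-(Matrix.trace (S * Matrix.of W.1)) / 2) :=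
    (lapFun n S hS).continuous
  rw [integral_eq_lintegral_of_nonneg_ae (ae_of_all _ fun W => (Real.exp_pos _).le)
    hc.measurable.aestronglyMeasurable,
    integral_eq_lintegral_of_nonneg_ae (ae_of_all _ fun W => (Real.exp_pos _).le)
    hc.measurable.aestronglyMeasurable]
  congr 1
  obtain ⟨A, hA, hA0⟩ := exists_root S hS
  have hm := hc.measurable.ennreal_ofReal
  rw [lintegral_smul_measure, lintegral_map hm measurable_phi, lintegral_map hm measurable_phi,
    lintegral_withDensity_eq_lintegral_mul _ hsm (show Measurable fun Y : Fin n → Fin d → ℝ =>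
      ENNReal.ofReal (Real.exp (-(S * Matrix.of (phi Y).1).trace / 2)) from
      hm.comp measurable_phi), smul_eq_mul]
  simp only [Pi.mul_apply, phi_gram]
  have k1 := key_lap A S hA hA0 (fun Y : Fin n → Fin d → ℝ => ENNReal.ofReal (sd (phi Y))) hsm
  have k2 := key_lap A S hA hA0 (fun _ : Fin n → Fin (d + 1) → ℝ => 1) measurable_const
  simp only [one_mul, lintegral_const, measure_univ, mul_one] at k2
  change ∫⁻ Y, ENNReal.ofReal (Real.exp (-(S * gram Y).trace / 2)) ∂_ = _ at k2
  rw [k2]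
  simp only [sd_leftMul, ENNReal.ofReal_mul (abs_nonneg A.det), mul_assoc] at k1
  have hmm : Measurable fun Y : Fin n → Fin d → ℝ => ENNReal.ofReal (sd (phi Y)) *
      ENNReal.ofReal (Real.exp (-(S * gram Y).trace / 2)) := by
    refine hsm.mul ?_
    have := hm.comp (measurable_phi (n := n) (d := d))
    simpa only [Function.comp_def, phi_gram] using this
  change ∫⁻ Y, ENNReal.ofReal |A.det| * (ENNReal.ofReal (sd (phi Y)) *
      ENNReal.ofReal (Real.exp (-(S * gram Y).trace / 2))) ∂_ = _ at k1
  rw [lintegral_const_mul _ hmm] at k1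
  have hp : 0 < |A.det| := abs_pos.2 hA0
  have h0 : ENNReal.ofReal |A.det| ≠ 0 := by simpa using hA0
  rw [← ENNReal.mul_right_inj h0 ENNReal.ofReal_ne_top, k1, mul_left_comm, mul_comm]
  congr 1
  rw [← ENNReal.ofReal_mul hp.le, abs_inv, abs_inv, abs_pow, abs_pow]
  congr 1
  field_simp
  ring

lemma memLp_eval {d : ℕ} (k : Fin d) :
    MemLp (fun y : Fin d → ℝ => y k) 2 (Measure.pi fun _ : Fin d => gaussianReal 0 1) :=
  (memLp_id_gaussianReal (μ := 0) (v := 1) 2).comp_measurePreserving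
    (measurePreserving_eval (fun _ : Fin d => gaussianReal 0 1) k)

lemma integrable_row {d : ℕ} (k l : Fin d) :
    Integrable (fun y : Fin d → ℝ => y k * y l) (Measure.pi fun _ : Fin d => gaussianReal 0 1) :=
  (memLp_eval k).integrable_mul (memLp_eval l)

lemma integral_row {d : ℕ} (k l : Fin d) :
    ∫ y : Fin d → ℝ, y k * y l ∂(Measure.pi fun _ : Fin d => gaussianReal 0 1) =
      if k = l then 1 else 0 := by
  split_ifs with h
  · subst h
    have h1 : ∫ x, x * x ∂(gaussianReal 0 1) = 1 := by
      have := variance_id_gaussianReal (μ := 0) (v := 1)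
      rw [variance_of_integral_eq_zero (by fun_prop) (by simp)] at this
      simpa [sq] using this
    rw [← h1]
    exact integral_comp_eval (μ := fun _ : Fin d => gaussianReal 0 1) (i := k)
      (f := fun x : ℝ => x * x) (by fun_prop)
  · have hp : ∀ y : Fin d → ℝ, y k * y l =
        ∏ m, (if m = k then y m else 1) * (if m = l then y m else 1) := by
      intro y
      rw [Finset.prod_mul_distrib]
      simp
    simp only [hp]
    rw [integral_fintype_prod_eq_prod (μ := fun _ : Fin d => gaussianReal 0 1)
      (f := fun m x => (if m = k then x else 1) * (if m = l then x else (1 : ℝ)))]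
    refine Finset.prod_eq_zero (Finset.mem_univ k) ?_
    simp [h]

lemma det_expand {n d : ℕ} (Y : Fin n → Fin d → ℝ) :
    (gram Y).det = ∑ σ : Equiv.Perm (Fin n), ∑ f : Fin n → Fin d,
      ((Equiv.Perm.sign σ : ℤ) : ℝ) * ∏ i, Y i (f (σ⁻¹ i)) * Y i (f i) := by
  rw [Matrix.det_apply']
  refine Finset.sum_congr rfl fun σ _ => ?_
  rw [← Finset.mul_sum]
  congr 1
  simp only [gram_apply]
  rw [Finset.prod_univ_sum, Fintype.piFinset_univ]
  refine Finset.sum_congr rfl fun f _ => ?_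
  rw [Finset.prod_mul_distrib, Finset.prod_mul_distrib]
  congr 1
  rw [← Equiv.prod_comp σ fun i => Y i (f (σ⁻¹ i))]
  simp

lemma integrable_term {n d : ℕ} (σ : Equiv.Perm (Fin n)) (f : Fin n → Fin d) :
    Integrable (fun Y : Fin n → Fin d → ℝ => ∏ i, Y i (f (σ⁻¹ i)) * Y i (f i)) (GM n d) :=
  Integrable.fintype_prod_dep
    (f := fun i (y : Fin d → ℝ) => y (f (σ⁻¹ i)) * y (f i)) fun _ => integrable_row _ _

lemma integrable_det (n d : ℕ) :
    Integrable (fun Y : Fin n → Fin d → ℝ => (gram Y).det) (GM n d) := by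
  simp only [det_expand]
  exact integrable_finsetSum _ fun σ _ => integrable_finsetSum _ fun f _ =>
    (integrable_term σ f).const_mul _

lemma integral_det (n d : ℕ) :
    ∫ Y : Fin n → Fin d → ℝ, (gram Y).det ∂(GM n d) = d.descFactorial n := by
  simp only [det_expand]
  rw [integral_finsetSum _ fun σ _ => integrable_finsetSum _ fun f _ =>
    (integrable_term σ f).const_mul _]
  simp_rw [integral_finsetSum _ fun f _ => (integrable_term _ f).const_mul _]
  rw [Finset.sum_comm]
  have h1 : ∀ f : Fin n → Fin d, ∑ σ : Equiv.Perm (Fin n),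
      ∫ Y : Fin n → Fin d → ℝ, ((Equiv.Perm.sign σ : ℤ) : ℝ) * ∏ i, Y i (f (σ⁻¹ i)) * Y i (f i)
        ∂(GM n d) = if Function.Injective f then 1 else 0 := by
    intro f
    have h2 : ∀ σ : Equiv.Perm (Fin n),
      ∫ Y : Fin n → Fin d → ℝ, ((Equiv.Perm.sign σ : ℤ) : ℝ) * ∏ i, Y i (f (σ⁻¹ i)) * Y i (f i)
        ∂(GM n d) = ((Equiv.Perm.sign σ : ℤ) : ℝ) * ∏ i,
          (Matrix.of fun i j => if f j = f i then (1 : ℝ) else 0) (σ i) i := by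
      intro σ
      rw [integral_const_mul, integral_fintype_prod_eq_prod
        (f := fun i (y : Fin d → ℝ) => y (f (σ⁻¹ i)) * y (f i))]
      simp only [integral_row]
      rw [← Equiv.prod_comp σ]
      simp
    simp only [h2]
    rw [← Matrix.det_apply']
    split_ifs with hf
    · have : (Matrix.of fun i j => if f j = f i then (1 : ℝ) else 0) = 1 := by
        ext i j
        simp [Matrix.one_apply, hf.eq_iff, eq_comm]
      rw [this, Matrix.det_one]
    · rw [Function.Injective] at hf
      push Not at hf
      obtain ⟨a, b, hab, hne⟩ := hf
      refine Matrix.det_zero_of_row_eq hne ?_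
      ext j
      simp [hab]
  simp only [h1]
  classical
  rw [Finset.sum_boole]
  congr 1
  rw [← Fintype.card_subtype, Fintype.card_congr (Equiv.subtypeInjectiveEquivEmbedding _ _),
    Fintype.card_embedding_eq]
  simp

lemma integrable_sd (n d : ℕ) :
    Integrable (fun Y : Fin n → Fin d → ℝ => sd (phi Y)) (GM n d) := by
  refine Integrable.mono' ((integrable_det n d).add (integrable_const (1 : ℝ)))
    (measurable_sd.comp measurable_phi).aestronglyMeasurable (ae_of_all _ fun Y => ?_)
  have h0 : 0 ≤ sd (phi Y) := Real.sqrt_nonneg _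
  rw [Real.norm_of_nonneg h0]
  simp only [Pi.add_apply]
  rw [← sd_sq]
  nlinarith [sq_nonneg (sd (phi Y) - 1)]

noncomputable def aa (n d : ℕ) : ℝ := ∫ Y : Fin n → Fin d → ℝ, sd (phi Y) ∂(GM n d)

lemma aa_nonneg (n d : ℕ) : 0 ≤ aa n d := integral_nonneg fun _ => Real.sqrt_nonneg _

lemma ofReal_aa (n d : ℕ) :
    ENNReal.ofReal (aa n d) = ∫⁻ Y, ENNReal.ofReal (sd (phi Y)) ∂(GM n d) :=
  ofReal_integral_eq_lintegral_ofReal (integrable_sd n d)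
    (ae_of_all _ fun _ => Real.sqrt_nonneg _)

lemma tilt' (n d : ℕ) :
    ((GM n d).withDensity fun Y => ENNReal.ofReal (sd (phi Y))).map phi =
      ENNReal.ofReal (aa n d) • (GM n (d + 1)).map phi := by
  rw [ofReal_aa]
  exact tilt (by rw [← ofReal_aa]; exact ENNReal.ofReal_ne_top)

lemma aa_mul (n d : ℕ) : aa n d * aa n (d + 1) = d.descFactorial n := by
  have hsm : Measurable fun Y : Fin n → Fin d → ℝ => ENNReal.ofReal (sd (phi Y)) :=
    (measurable_sd.comp measurable_phi).ennreal_ofReal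
  have h := congrArg (fun μ => ∫⁻ W, ENNReal.ofReal (sd W) ∂μ) (tilt' n d)
  simp only [lintegral_smul_measure] at h
  rw [lintegral_map measurable_sd.ennreal_ofReal measurable_phi,
    lintegral_map measurable_sd.ennreal_ofReal measurable_phi, ← ofReal_aa,
    lintegral_withDensity_eq_lintegral_mul _ hsm hsm, smul_eq_mul,
    ← ENNReal.ofReal_mul (aa_nonneg n d)] at h
  simp only [Pi.mul_apply, ← ENNReal.ofReal_mul (sd_nonneg _), sd_sq] at h
  rw [← ofReal_integral_eq_lintegral_ofReal (integrable_det n d)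
    (ae_of_all _ fun Y => (gram_psd Y).det_nonneg), integral_det] at h
  exact ((ENNReal.ofReal_eq_ofReal_iff (by positivity)
    (mul_nonneg (aa_nonneg _ _) (aa_nonneg _ _))).1 h).symm

lemma sq_integral_le' {Ω : Type*} [MeasurableSpace Ω] (μ : Measure Ω) [IsProbabilityMeasure μ]
    (f : Ω → ℝ) (hf : Integrable f μ) (hf2 : Integrable (fun x => f x * f x) μ) :
    (∫ x, f x ∂μ) ^ 2 ≤ ∫ x, f x * f x ∂μ := by
  set c := ∫ x, f x ∂μ with hc
  have h0 : 0 ≤ ∫ x, (f x * f x - 2 * c * f x + c ^ 2) ∂μ :=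
    integral_nonneg fun x => by
      have : f x * f x - 2 * c * f x + c ^ 2 = (f x - c) ^ 2 := by ring
      simp only [Pi.zero_apply]
      rw [this]; positivity
  have h1 : Integrable (fun x => f x * f x - 2 * c * f x) μ := hf2.sub (hf.const_mul _)
  rw [integral_add h1 (integrable_const _),
    integral_sub hf2 (hf.const_mul _), integral_const_mul, ← hc] at h0
  simp at h0
  nlinarith

lemma integrable_sd2 (n d : ℕ) :
    Integrable (fun Y : Fin n → Fin d → ℝ => sd (phi Y) * sd (phi Y)) (GM n d) := by
  simp only [sd_sq]; exact integrable_det n d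

lemma aa_sq_le (n d : ℕ) : aa n d ^ 2 ≤ d.descFactorial n := by
  have := sq_integral_le' (GM n d) _ (integrable_sd n d) (integrable_sd2 n d)
  simp only [sd_sq, integral_det] at this
  exact this

lemma tv_event (n d : ℕ) (B : Set (Fin n → Fin n → ℝ)) (hB : MeasurableSet B) :
    aa n d * |(wishartLaw n d B).toReal - (wishartLaw n (d + 1) B).toReal| ≤
      Real.sqrt (d.descFactorial n - aa n d ^ 2) := by
  set E : Set (Fin n → Fin d → ℝ) := phi ⁻¹' (Subtype.val ⁻¹' B) with hE
  have hB' : MeasurableSet (Subtype.val ⁻¹' B : Set (WX n)) := measurable_subtype_coe hB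
  have hEm : MeasurableSet E := measurable_phi hB'
  have h1 : (wishartLaw n d B).toReal = (GM n d).real E := by
    rw [wishart_eq, Measure.map_apply measurable_subtype_coe hB,
      Measure.map_apply measurable_phi hB']
    rfl
  have h2 : aa n d * (wishartLaw n (d + 1) B).toReal = ∫ Y in E, sd (phi Y) ∂(GM n d) := by
    have h := congrArg (fun μ => μ (Subtype.val ⁻¹' B)) (tilt' n d)
    simp only [Measure.smul_apply, smul_eq_mul] at h
    rw [Measure.map_apply measurable_phi hB', ← Measure.map_apply measurable_subtype_coe hB,
      ← wishart_eq, withDensity_apply _ hEm,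
      ← ofReal_integral_eq_lintegral_ofReal (integrable_sd n d).integrableOn
        (ae_of_all _ fun _ => Real.sqrt_nonneg _)] at h
    have h' := congrArg ENNReal.toReal h
    rw [ENNReal.toReal_mul, ENNReal.toReal_ofReal (aa_nonneg n d),
      ENNReal.toReal_ofReal (integral_nonneg fun _ => sd_nonneg _)] at h'
    exact h'.symm
  have hi : Integrable (fun Y : Fin n → Fin d → ℝ => aa n d - sd (phi Y)) (GM n d) :=
    (integrable_const _).sub (integrable_sd n d)
  have h3 : aa n d * ((wishartLaw n d B).toReal - (wishartLaw n (d + 1) B).toReal) =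
      ∫ Y in E, (aa n d - sd (phi Y)) ∂(GM n d) := by
    rw [integral_sub (integrable_const _).integrableOn (integrable_sd n d).integrableOn, ← h2,
      mul_sub, h1]
    simp [mul_comm]
  have hsq : (fun Y : Fin n → Fin d → ℝ => |aa n d - sd (phi Y)| * |aa n d - sd (phi Y)|) =
      fun Y => sd (phi Y) * sd (phi Y) - 2 * aa n d * sd (phi Y) + aa n d ^ 2 := by
    ext Y
    rw [abs_mul_abs_self]; ring
  have hi1 : Integrable (fun Y : Fin n → Fin d → ℝ =>
      sd (phi Y) * sd (phi Y) - 2 * aa n d * sd (phi Y)) (GM n d) :=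
    (integrable_sd2 n d).sub ((integrable_sd n d).const_mul (2 * aa n d))
  have hi2 : Integrable (fun Y : Fin n → Fin d → ℝ =>
      |aa n d - sd (phi Y)| * |aa n d - sd (phi Y)|) (GM n d) := by
    rw [hsq]
    exact hi1.add (integrable_const _)
  have h4 := sq_integral_le' (GM n d) _ hi.abs hi2
  have h5 : ∫ Y : Fin n → Fin d → ℝ, |aa n d - sd (phi Y)| * |aa n d - sd (phi Y)| ∂(GM n d) =
      d.descFactorial n - aa n d ^ 2 := by
    rw [hsq, integral_add hi1 (integrable_const _),
      integral_sub (integrable_sd2 n d) ((integrable_sd n d).const_mul (2 * aa n d)),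
      integral_const_mul]
    simp only [sd_sq, integral_det]
    change _ - 2 * aa n d * aa n d + _ = _
    simp
    ring
  rw [h5] at h4
  calc aa n d * |(wishartLaw n d B).toReal - (wishartLaw n (d + 1) B).toReal|
      = |∫ Y in E, (aa n d - sd (phi Y)) ∂(GM n d)| := by
        rw [← h3, abs_mul, abs_of_nonneg (aa_nonneg n d)]
    _ ≤ ∫ Y in E, |aa n d - sd (phi Y)| ∂(GM n d) := abs_integral_le_integral_abs
    _ ≤ ∫ Y, |aa n d - sd (phi Y)| ∂(GM n d) :=
        setIntegral_le_integral hi.abs (ae_of_all _ fun _ => abs_nonneg _)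
    _ ≤ _ := Real.le_sqrt_of_sq_le h4

/-- Eldan's bound: there is a universal constant `C > 0` such that for all `n < d`,
`TV(W(n,d), W(n,d+1)) ≤ C √(((d+1)/(d-n))² - 1)`. -/
theorem tv_wishart_consecutive :
    ∃ C : ℝ, 0 < C ∧ ∀ n d : ℕ, 0 < n → n < d →
      tvDist (wishartLaw n d) (wishartLaw n (d + 1))
        ≤ C * Real.sqrt ((((d : ℝ) + 1) / ((d : ℝ) - (n : ℝ))) ^ 2 - 1) := by
  refine ⟨1, one_pos, fun n d hn hnd => ?_⟩
  rw [one_mul]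
  obtain ⟨e, rfl⟩ : ∃ e, d = e + 1 := ⟨d - 1, by omega⟩
  have hm : (0 : ℝ) < ((e + 1 : ℕ) : ℝ) - n := by
    have : (n : ℝ) < ((e + 1 : ℕ) : ℝ) := by exact_mod_cast hnd
    linarith
  have hD : (((e + 1 : ℕ) : ℝ) - n) * ((e + 1).descFactorial n : ℝ) =
      ((e + 1 : ℕ) : ℝ) * (e.descFactorial n : ℝ) := by
    have := Nat.succ_descFactorial e n
    have h2 : (((e + 1 - n : ℕ) : ℕ) : ℝ) = ((e + 1 : ℕ) : ℝ) - n := Nat.cast_sub hnd.le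
    rw [← h2]
    exact_mod_cast this
  have hDe : (0 : ℝ) < (e.descFactorial n : ℝ) := by
    have : e.descFactorial n ≠ 0 := by
      rw [Ne, Nat.descFactorial_eq_zero_iff_lt]; omega
    positivity
  have m1 := aa_mul n e
  have m2 := aa_mul n (e + 1)
  have s1 := aa_sq_le n e
  have p0 := aa_nonneg n e
  have p1 := aa_nonneg n (e + 1)
  have q0 : 0 < aa n e := by
    rcases p0.lt_or_eq with h | h
    · exact h
    · rw [← h, zero_mul] at m1; linarith
  have q1 : 0 < aa n (e + 1) := by
    rcases p1.lt_or_eq with h | h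
    · exact h
    · rw [← h, mul_zero] at m1; linarith
  have mono : aa n e ≤ aa n (e + 1) := by
    rw [← m1, sq] at s1
    exact le_of_mul_le_mul_left s1 q0
  unfold tvDist
  have : Nonempty {A : Set (Fin n → Fin n → ℝ) // MeasurableSet A} := ⟨⟨∅, MeasurableSet.empty⟩⟩
  refine ciSup_le fun B => ?_
  have hB := tv_event n (e + 1) B.1 B.2
  have key : ((e + 1).descFactorial n : ℝ) - aa n (e + 1) ^ 2 ≤
      aa n (e + 1) ^ 2 * (((((e + 1 : ℕ) : ℝ) + 1) / (((e + 1 : ℕ) : ℝ) - (n : ℝ))) ^ 2 - 1) := by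
    set D : ℝ := ((e + 1 : ℕ) : ℝ) with hDdef
    have hD0 : 0 ≤ D := Nat.cast_nonneg _
    have hn0 : (0 : ℝ) ≤ n := Nat.cast_nonneg _
    have hx1 : 1 ≤ (D + 1) / (D - n) := by
      rw [one_le_div hm]; linarith
    have hx2 : D / (D - n) ≤ ((D + 1) / (D - n)) ^ 2 := by
      calc D / (D - n) ≤ (D + 1) / (D - n) := by gcongr; linarith
        _ ≤ _ := by nlinarith
    have hdf : ((e + 1).descFactorial n : ℝ) = D / (D - n) * (aa n e * aa n (e + 1)) := by
      rw [m1]; field_simp; linarith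
    have h6 : aa n e * aa n (e + 1) ≤ aa n (e + 1) ^ 2 := by
      rw [sq]; gcongr
    have h7 : D / (D - n) * (aa n e * aa n (e + 1)) ≤
        ((D + 1) / (D - n)) ^ 2 * aa n (e + 1) ^ 2 := by
      gcongr
    rw [hdf]
    linarith
  refine le_of_mul_le_mul_left (hB.trans ?_) q1
  calc _ ≤ Real.sqrt (aa n (e + 1) ^ 2 *
        (((((e + 1 : ℕ) : ℝ) + 1) / (((e + 1 : ℕ) : ℝ) - (n : ℝ))) ^ 2 - 1)) :=
        Real.sqrt_le_sqrt key
    _ = _ := by rw [Real.sqrt_mul (sq_nonneg _), Real.sqrt_sq p1]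
end
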